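/- Suppose d' = 2d. Then, as (α,β,γ) ranges over F_{p^m} × F_q × F_q, the value S(α,β,γ) equals: −p^m for exactly p^{m+3d−1}(p^m−1)(p^m−p+1)(p^n−p^{n−2d}−p^{n−3d}+p^m−p^{m−d}+1)/((p^d+1)(p^{2d}−1)) triples; for each j with 1 ≤ j ≤ p−1, −ζ_p^j·p^m for exactly p^{m+3d−1}(p^n−1)(p^n−p^{n−2d}−p^{n−3d}+p^m−p^{m−d}+1)/((p^d+1)(p^{2d}−1)) triples; p^{m+d} for exactly p^{m−1}(p^n−1)(p^{m−d}+p−1)(p^m+p^{m−d}+p^{m−2d}+1)/(p^d+1)^2 triples; for each j with 1 ≤ j ≤ p−1, ζ_p^j·p^{m+d} for exactly p^{m−1}(p^n−1)(p^{m−d}−1)(p^m+p^{m−d}+p^{m−2d}+1)/(p^d+1)^2 triples; −p^{m+2d} for exactly p^{m−2d−1}(p^{m−d}−1)(p^{m−2d}−p+1)(p^n−1)/((p^d+1)(p^{2d}−1)) triples; for each j with 1 ≤ j ≤ p−1, −ζ_p^j·p^{m+2d} for exactly p^{m−2d−1}(p^{m−d}−1)(p^{m−2d}+1)(p^n−1)/((p^d+1)(p^{2d}−1))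 triples; 0 for exactly (p^n−1)(p^{3m−d}−p^{3m−2d}+p^{3m−3d}−p^{3m−4d}+p^{3m−5d}+p^{n−d}−2p^{n−2d}+p^{n−3d}−p^{n−4d}+1) triples; and p^n for exactly 1 triple; S takes no other values. -/

import Mathlib

open scoped BigOperators Classical

noncomputable section

/-- The map `φ_{α,β}(x) = α x^{p^m} + β x^{p^k} + β^{p^{n-k}} x^{p^{n-k}}`. -/
def phiMap (p m n k : ℕ) {F : Type} [Field F] (α β x : F) : F :=
  α * x ^ p ^ m + β * x ^ p ^ k + β ^ p ^ (n - k) * x ^ p ^ (n - k)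

/-- The trace-type sum `x ↦ ∑_{i<r} x^{p^{t i}}`; for `x` in the subfield of size
`p^{t·r}` this is the relative trace down to the subfield of size `p^t`. -/
def trSum (p t r : ℕ) {F : Type} [Field F] (x : F) : F :=
  ∑ i ∈ Finset.range r, x ^ p ^ (t * i)

/-- `ζ_p^c = exp(2πi·c̃/p)` for a lift `c̃` of `c : F_p`. -/
noncomputable def expChar (p : ℕ) (c : ZMod p) : ℂ :=
  Complex.exp (2 * Real.pi * Complex.I * (c.val : ℂ) / (p : ℂ))

/-- Identify an element of the prime field of `F` with an element of `ZMod p`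
(the partial inverse of the algebra map). -/
noncomputable def fToZMod (p : ℕ) {F : Type} [Field F] [Algebra (ZMod p) F] (x : F) : ZMod p :=
  letI : Nonempty (ZMod p) := ⟨0⟩
  Function.invFun (algebraMap (ZMod p) F) x

/-- `T(α,β) = ∑_{x ∈ F_q} ζ_p^{Tr^m_1(α x^{p^m+1}) + Tr^n_1(β x^{p^k+1})}`. -/
noncomputable def Tsum (p m n k : ℕ) (F : Type) [Field F] [Fintype F] [Algebra (ZMod p) F]
    (α β : F) : ℂ :=
  ∑ x : F, expChar p (fToZMod p (trSum p 1 m (α * x ^ (p ^ m + 1))) +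
      fToZMod p (trSum p 1 n (β * x ^ (p ^ k + 1))))

/-- `S(α,β,γ) = ∑_{x ∈ F_q} ζ_p^{Tr^m_1(α x^{p^m+1}) + Tr^n_1(β x^{p^k+1} + γ x)}`. -/
noncomputable def Ssum (p m n k : ℕ) (F : Type) [Field F] [Fintype F] [Algebra (ZMod p) F]
    (α β γ : F) : ℂ :=
  ∑ x : F, expChar p (fToZMod p (trSum p 1 m (α * x ^ (p ^ m + 1))) +
      fToZMod p (trSum p 1 n (β * x ^ (p ^ k + 1) + γ * x)))

/-- `√(q₀*)` where `q₀* = (−1)^{(q₀−1)/2} q₀`. -/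
noncomputable def sqrtStar (q0 : ℕ) : ℂ :=
  if q0 % 4 = 1 then (Real.sqrt q0 : ℂ) else Complex.I * (Real.sqrt q0 : ℂ)

/-- `ζ_p = exp(2πi/p)`. -/
noncomputable def zetaC (p : ℕ) : ℂ := Complex.exp (2 * Real.pi * Complex.I / (p : ℂ))

/-- Number of pairs `(α,β) ∈ F_{p^m} × F_q` with `T(α,β) = v`. -/
noncomputable def Tcount (p m n k : ℕ) (F : Type) [Field F] [Fintype F] [Algebra (ZMod p) F]
    (v : ℂ) : ℕ :=
  Nat.card {ab : F × F // ab.1 ^ p ^ m = ab.1 ∧ Tsum p m n k F ab.1 ab.2 = v}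

/-- Number of triples `(α,β,γ) ∈ F_{p^m} × F_q × F_q` with `S(α,β,γ) = v`. -/
noncomputable def Scount (p m n k : ℕ) (F : Type) [Field F] [Fintype F] [Algebra (ZMod p) F]
    (v : ℂ) : ℕ :=
  Nat.card {abc : F × F × F // abc.1 ^ p ^ m = abc.1 ∧ Ssum p m n k F abc.1 abc.2.1 abc.2.2 = v}

/-- Hamming weight of the codeword of `C₁` attached to `(α,β)`:
the number of `0 ≤ i ≤ q-2` with `Tr^m_t(α π^{i(p^m+1)}) + Tr^n_t(β π^{i(p^k+1)}) ≠ 0`. -/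
noncomputable def wt1 (p m n k t : ℕ) {F : Type} [Field F] (π α β : F) : ℕ :=
  Nat.card {i : ℕ // i ≤ p ^ n - 2 ∧
    trSum p t (m / t) (α * π ^ (i * (p ^ m + 1))) +
    trSum p t (n / t) (β * π ^ (i * (p ^ k + 1))) ≠ 0}

/-- Number of pairs `(α,β) ∈ F_{p^m} × F_q` whose `C₁`-codeword has weight `v`. -/
noncomputable def wt1count (p m n k t : ℕ) (F : Type) [Field F] [Fintype F] (π : F) (v : ℕ) : ℕ :=
  Nat.card {ab : F × F // ab.1 ^ p ^ m = ab.1 ∧ wt1 p m n k t π ab.1 ab.2 = v}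

/-- Hamming weight of the codeword of `C₂` attached to `(α,β,γ)`. -/
noncomputable def wt2 (p m n k t : ℕ) {F : Type} [Field F] (π α β γ : F) : ℕ :=
  Nat.card {i : ℕ // i ≤ p ^ n - 2 ∧
    trSum p t (m / t) (α * π ^ (i * (p ^ m + 1))) +
    trSum p t (n / t) (β * π ^ (i * (p ^ k + 1)) + γ * π ^ i) ≠ 0}

/-- Number of triples `(α,β,γ)` whose `C₂`-codeword has weight `v`. -/
noncomputable def wt2count (p m n k t : ℕ) (F : Type) [Field F] [Fintype F] (π : F) (v : ℕ) : ℕ :=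
  Nat.card {abc : F × F × F // abc.1 ^ p ^ m = abc.1 ∧ wt2 p m n k t π abc.1 abc.2.1 abc.2.2 = v}

section GaussSums

variable {p : ℕ} [Fact p.Prime]

lemma sum_stdAddChar_comp {A : Type*} [AddCommGroup A] [Fintype A] (φ : A →+ ZMod p) :
    ∑ a, (ZMod.stdAddChar (φ a) : ℂ) = if φ = 0 then (Fintype.card A : ℂ) else 0 := by
  have h := AddChar.sum_eq_ite ((ZMod.stdAddChar (N := p)).compAddMonoidHom φ)
  simp only [AddChar.compAddMonoidHom_apply] at h
  rw [h]
  congr 1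
  refine propext ⟨fun h0 => ?_, fun h0 => ?_⟩
  · ext a
    apply ZMod.injective_stdAddChar
    have := DFunLike.congr_fun h0 a
    simpa using this
  · ext a
    simp [h0]

lemma conj_stdAddChar (a : ZMod p) :
    (starRingEnd ℂ) (ZMod.stdAddChar a) = ZMod.stdAddChar (-a) := by
  rw [ZMod.stdAddChar_apply, ZMod.stdAddChar_apply, AddChar.map_neg_eq_inv, Circle.coe_inv_eq_conj]

variable {F : Type} [Field F] [Fintype F]

/-- `f` is a quadratic form on `F` over the prime field, with polarization
`(x, y) ↦ tr (x * L y)` relative to a nondegenerate functional `tr`, all of whose multiples by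
nonzero scalars are isometric to `f` itself. -/
structure IsScalableForm (tr : F →+ ZMod p) (f : F → ZMod p) (L : F →+ F) : Prop where
  nondeg : ∀ c, (∀ x, tr (x * c) = 0) → c = 0
  polar : ∀ x y, f (x + y) = f x + f y + tr (x * L y)
  even : ∀ x, f (-x) = f x
  scale : ∀ t : ZMod p, t ≠ 0 → ∃ s : F, s ≠ 0 ∧ ∀ x, f (s * x) = t * f x

/-- The exponential sum of `f` twisted by the linear functional `tr (γ * ·)`. -/
def twistedSum (tr : F →+ ZMod p) (f : F → ZMod p) (γ : F) : ℂ :=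
  ∑ x, ZMod.stdAddChar (f x + tr (γ * x))

lemma sum_stdAddChar_mul {tr : F →+ ZMod p} (nondeg : ∀ c, (∀ x, tr (x * c) = 0) → c = 0) (c : F) :
    ∑ x, (ZMod.stdAddChar (tr (x * c)) : ℂ) = if c = 0 then (Fintype.card F : ℂ) else 0 := by
  have h := sum_stdAddChar_comp (tr.comp (AddMonoidHom.mulRight c))
  simp only [AddMonoidHom.comp_apply, AddMonoidHom.coe_mulRight] at h
  rw [h]
  congr 1
  refine propext ⟨fun h0 => nondeg c fun x => ?_, fun h0 => ?_⟩
  · simpa using DFunLike.congr_fun h0 x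
  · ext x
    simp [h0]

namespace IsScalableForm

variable {tr : F →+ ZMod p} {f : F → ZMod p} {L : F →+ F} (hf : IsScalableForm tr f L)
include hf

omit [Fintype F] in
lemma map_zero : f 0 = 0 := by simpa using hf.polar 0 0

omit [Fintype F] in
lemma map_ker (hp : p ≠ 2) {x : F} (hx : L x = 0) : f x = 0 := by
  have h := hf.polar (-x) x
  rw [neg_add_cancel, hf.map_zero, hf.even, hx, mul_zero, _root_.map_zero, add_zero, ← two_mul] at h
  have h2 : (2 : ZMod p) ≠ 0 := by
    intro h2
    have : ((2 : ℕ) : ZMod p) = 0 := by exact_mod_cast h2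
    rw [ZMod.natCast_eq_zero_iff] at this
    exact hp ((Nat.prime_dvd_prime_iff_eq Fact.out Nat.prime_two).1 this)
  exact (mul_eq_zero.1 h.symm).resolve_left h2

lemma twistedSum_apply (y : F) :
    twistedSum tr f (L y) = ZMod.stdAddChar (-f y) * twistedSum tr f 0 := by
  have h : twistedSum tr f 0 = ∑ x, (ZMod.stdAddChar (f (x + y)) : ℂ) := by
    rw [twistedSum, ← Equiv.sum_comp (Equiv.addRight y)]
    simp
  rw [h, twistedSum, Finset.mul_sum]
  refine Finset.sum_congr rfl fun x _ => ?_
  rw [← AddChar.map_add_eq_mul, hf.polar, mul_comm (L y)]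
  congr 1
  ring

lemma twistedSum_mul_conj (hp : p ≠ 2) (γ : F) :
    twistedSum tr f γ * (starRingEnd ℂ) (twistedSum tr f γ) =
      Fintype.card F * ∑ u with L u = 0, ZMod.stdAddChar (tr (u * γ)) := by
  have h1 : twistedSum tr f γ * (starRingEnd ℂ) (twistedSum tr f γ) =
      ∑ y, ∑ u, (ZMod.stdAddChar (f u + tr (u * γ)) : ℂ) * ZMod.stdAddChar (tr (y * L u)) := by
    rw [twistedSum, map_sum, Finset.mul_sum]
    refine Finset.sum_congr rfl fun y _ => ?_
    rw [Finset.sum_mul, ← Equiv.sum_comp (Equiv.addLeft y)]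
    refine Finset.sum_congr rfl fun u _ => ?_
    rw [conj_stdAddChar, ← AddChar.map_add_eq_mul, ← AddChar.map_add_eq_mul]
    congr 1
    simp only [Equiv.coe_addLeft, hf.polar, mul_add, map_add, mul_comm u γ]
    ring
  rw [h1, Finset.sum_comm, Finset.sum_filter, Finset.mul_sum]
  refine Finset.sum_congr rfl fun u _ => ?_
  rw [← Finset.mul_sum, sum_stdAddChar_mul hf.nondeg]
  split_ifs with hu
  · rw [hf.map_ker hp hu, zero_add, mul_comm]
  · simp

lemma twistedSum_zero_mul_conj (hp : p ≠ 2) :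
    twistedSum tr f 0 * (starRingEnd ℂ) (twistedSum tr f 0) =
      Fintype.card F * (Finset.univ.filter fun u => L u = 0).card := by
  rw [hf.twistedSum_mul_conj hp]
  simp

omit hf in
lemma card_image_mul_card_ker (L : F →+ F) :
    (Finset.univ.image L).card * (Finset.univ.filter fun u => L u = 0).card = Fintype.card F := by
  rw [← Finset.card_univ, Finset.card_eq_sum_card_image L Finset.univ, Finset.sum_const_nat]
  intro b hb
  obtain ⟨a, -, rfl⟩ := Finset.mem_image.1 hb
  refine Finset.card_bij' (fun x _ => x - a) (fun x _ => x + a) ?_ ?_ ?_ ?_ <;>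
    simp +contextual

lemma twistedSum_eq_zero (hp : p ≠ 2) {γ : F} (hγ : γ ∉ Finset.univ.image L) :
    twistedSum tr f γ = 0 := by
  have htot : ∑ γ, Complex.normSq (twistedSum tr f γ) = (Fintype.card F : ℝ) ^ 2 := by
    have : ∑ γ, (Complex.normSq (twistedSum tr f γ) : ℂ) = (Fintype.card F : ℂ) ^ 2 := by
      simp_rw [← Complex.mul_conj, hf.twistedSum_mul_conj hp]
      rw [← Finset.mul_sum, Finset.sum_comm]
      have h : ∀ u : F, ∑ γ, (ZMod.stdAddChar (tr (u * γ)) : ℂ) =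
          if u = 0 then (Fintype.card F : ℂ) else 0 := fun u => by
        simp_rw [mul_comm u]
        exact sum_stdAddChar_mul hf.nondeg u
      simp_rw [h]
      simp [sq]
    exact_mod_cast this
  have himg : ∑ γ ∈ Finset.univ.image L, Complex.normSq (twistedSum tr f γ) =
      (Fintype.card F : ℝ) ^ 2 := by
    have h : ∀ γ ∈ Finset.univ.image L, Complex.normSq (twistedSum tr f γ) =
        Fintype.card F * (Finset.univ.filter fun u => L u = 0).card := by
      intro γ hγ
      obtain ⟨y, -, rfl⟩ := Finset.mem_image.1 hγ
      have h0 : Complex.normSq (twistedSum tr f 0) =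
        Fintype.card F * (Finset.univ.filter fun u => L u = 0).card := by
        have := hf.twistedSum_zero_mul_conj hp
        rw [Complex.mul_conj] at this
        exact_mod_cast this
      rw [hf.twistedSum_apply, map_mul, h0, ZMod.stdAddChar_apply, Circle.normSq_coe, one_mul]
    rw [Finset.sum_congr rfl h, Finset.sum_const, nsmul_eq_mul]
    have := card_image_mul_card_ker L
    have h' : ((Finset.univ.image L).card : ℝ) * (Finset.univ.filter fun u => L u = 0).card
      = Fintype.card F := by exact_mod_cast this
    linear_combination (Fintype.card F : ℝ) * h'
  have hz : ∑ γ ∈ Finset.univ \ Finset.univ.image L, Complex.normSq (twistedSum tr f γ) = 0 := by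
    have := Finset.sum_sdiff (f := fun γ => Complex.normSq (twistedSum tr f γ))
      (Finset.subset_univ (Finset.univ.image L))
    linarith
  rw [Finset.sum_eq_zero_iff_of_nonneg fun _ _ => Complex.normSq_nonneg _] at hz
  exact Complex.normSq_eq_zero.1 (hz γ (by simpa using hγ))

lemma card_fiber_mul (c : ZMod p) :
    (p : ℂ) * (Finset.univ.filter fun y => f y = c).card =
      Fintype.card F + twistedSum tr f 0 * (if c = 0 then (p : ℂ) - 1 else -1) := by
  have hT : ∀ t : ZMod p, t ≠ 0 → ∑ y, (ZMod.stdAddChar (t * f y) : ℂ) = twistedSum tr f 0 := by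
    intro t ht
    obtain ⟨s, hs, hst⟩ := hf.scale t ht
    have h := Equiv.sum_comp (Equiv.mulLeft₀ s hs) fun x => (ZMod.stdAddChar (f x) : ℂ)
    simpa [twistedSum, hst] using h
  have hsum : ∀ a : ZMod p, ∑ t : ZMod p, (ZMod.stdAddChar (t * a) : ℂ) =
      if a = 0 then (p : ℂ) else 0 := by
    intro a
    have h := AddChar.sum_mulShift a (ZMod.isPrimitive_stdAddChar p)
    simpa [ZMod.card] using h
  have h1 : (p : ℂ) * (Finset.univ.filter fun y => f y = c).card =
      ∑ t : ZMod p, ∑ y, (ZMod.stdAddChar (t * (f y - c)) : ℂ) := by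
    rw [Finset.sum_comm]
    simp_rw [hsum, sub_eq_zero]
    rw [← Finset.sum_filter, Finset.sum_const, nsmul_eq_mul, mul_comm]
  have h2 : ∑ t ∈ Finset.univ.erase (0 : ZMod p), (ZMod.stdAddChar (t * (-c)) : ℂ) =
      if c = 0 then (p : ℂ) - 1 else -1 := by
    have h := hsum (-c)
    rw [← Finset.add_sum_erase _ _ (Finset.mem_univ (0 : ZMod p))] at h
    simp only [zero_mul, AddChar.map_zero_eq_one, neg_eq_zero] at h
    split_ifs at h ⊢ <;> linear_combination h
  rw [h1, ← Finset.add_sum_erase _ _ (Finset.mem_univ (0 : ZMod p)), ← h2, Finset.mul_sum]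
  congr 1
  · simp
  · refine Finset.sum_congr rfl fun t ht => ?_
    rw [← hT t (Finset.ne_of_mem_erase ht), Finset.sum_mul]
    refine Finset.sum_congr rfl fun y _ => ?_
    rw [← AddChar.map_add_eq_mul]
    congr 1
    ring

lemma twistedSum_zero_eq_int :
    twistedSum tr f 0 =
      ((Fintype.card F - p * (Finset.univ.filter fun y => f y = 1).card : ℤ) : ℂ) := by
  have h := hf.card_fiber_mul 1
  rw [if_neg one_ne_zero] at h
  push_cast
  linear_combination h

lemma card_twistedSum_eq_zero (hp : p ≠ 2) :
    (Finset.univ.filter fun γ => twistedSum tr f γ = 0).card + (Finset.univ.image L).card =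
      Fintype.card F := by
  have hne : twistedSum tr f 0 ≠ 0 := by
    intro h0
    have h := hf.twistedSum_zero_mul_conj hp
    rw [h0, zero_mul, eq_comm, mul_eq_zero] at h
    rcases h with h | h
    · exact Fintype.card_ne_zero (Nat.cast_eq_zero.1 h)
    · have : (0 : F) ∈ Finset.univ.filter fun u => L u = 0 := by simp
      rw [Nat.cast_eq_zero, Finset.card_eq_zero] at h
      simp [h] at this
  have : (Finset.univ.filter fun γ => twistedSum tr f γ = 0) = (Finset.univ.image L)ᶜ := by
    ext γ
    rw [Finset.mem_filter, Finset.mem_compl]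
    refine ⟨fun h hγ => ?_, fun h => ⟨Finset.mem_univ _, hf.twistedSum_eq_zero hp h⟩⟩
    obtain ⟨y, -, rfl⟩ := Finset.mem_image.1 hγ
    have h2 := h.2
    rw [hf.twistedSum_apply] at h2
    exact mul_ne_zero (by rw [ZMod.stdAddChar_apply]; exact Circle.coe_ne_zero _) hne h2
  rw [this, Finset.card_compl_add_card]

lemma twistedSum_eq_iff (hp : p ≠ 2) (c : ZMod p) (hne : twistedSum tr f 0 ≠ 0) (γ : F) :
    twistedSum tr f γ = ZMod.stdAddChar c * twistedSum tr f 0 ↔ ∃ y, L y = γ ∧ f y = -c := by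
  constructor
  · intro h
    by_cases hγ : γ ∈ Finset.univ.image L
    · obtain ⟨y, -, rfl⟩ := Finset.mem_image.1 hγ
      rw [hf.twistedSum_apply] at h
      have := ZMod.injective_stdAddChar (mul_right_cancel₀ hne h)
      exact ⟨y, rfl, by rw [← this, neg_neg]⟩
    · rw [hf.twistedSum_eq_zero hp hγ, eq_comm] at h
      exact absurd h (mul_ne_zero (by rw [ZMod.stdAddChar_apply]; exact Circle.coe_ne_zero _) hne)
  · rintro ⟨y, rfl, hy⟩
    rw [hf.twistedSum_apply, hy, neg_neg]

lemma card_twistedSum_eq_mul (hp : p ≠ 2) (c : ZMod p) (hne : twistedSum tr f 0 ≠ 0) :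
    (Finset.univ.filter fun γ => twistedSum tr f γ = ZMod.stdAddChar c * twistedSum tr f 0).card *
        (Finset.univ.filter fun u => L u = 0).card =
      (Finset.univ.filter fun y => f y = -c).card := by
  have himg : (Finset.univ.filter
      fun γ => twistedSum tr f γ = ZMod.stdAddChar c * twistedSum tr f 0) =
      (Finset.univ.filter fun y => f y = -c).image L := by
    ext γ
    simp [hf.twistedSum_eq_iff hp c hne, and_comm]
  rw [himg, Finset.card_eq_sum_card_image L (Finset.univ.filter fun y => f y = -c),
    Finset.sum_const_nat]
  intro b hb
  obtain ⟨a, ha, rfl⟩ := Finset.mem_image.1 hb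
  have ha' : f a = -c := (Finset.mem_filter.1 ha).2
  have hadd : ∀ u, L u = 0 → f (a + u) = -c := by
    intro u hu
    rw [hf.polar, hu, hf.map_ker hp hu, ha', mul_zero, _root_.map_zero, add_zero, add_zero]
  refine Finset.card_bij' (fun x _ => x - a) (fun x _ => a + x) ?_ ?_ ?_ ?_
  · simp +contextual
  · simp +contextual [hadd]
  · simp
  · simp

end IsScalableForm

end GaussSums

section FiniteFields

lemma pow_expChar_gcd {F : Type*} [Field F] (p : ℕ) [Fact p.Prime] [CharP F p] {a b : ℕ} {x : F}
    (ha : x ^ p ^ a = x) (hb : x ^ p ^ b = x) : x ^ p ^ Nat.gcd a b = x := by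
  have h1 : Function.IsPeriodicPt (frobenius F p) a x := by
    rw [Function.IsPeriodicPt, Function.IsFixedPt, iterate_frobenius, ha]
  have h2 : Function.IsPeriodicPt (frobenius F p) b x := by
    rw [Function.IsPeriodicPt, Function.IsFixedPt, iterate_frobenius, hb]
  have h := h1.gcd h2
  rwa [Function.IsPeriodicPt, Function.IsFixedPt, iterate_frobenius] at h

lemma pow_odd_pow_add_one {F : Type*} [Field F] {s t : F} {Q : ℕ}
    (hs : s ^ (Q + 1) = t) (ht : t ^ Q = t) {j : ℕ} (hj : Odd j) : s ^ (Q ^ j + 1) = t := by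
  rcases eq_or_ne s 0 with rfl | h0
  · rw [← hs, zero_pow (Nat.succ_ne_zero _), zero_pow (Nat.succ_ne_zero _)]
  have h2 : s ^ (Q ^ 2) = s := by
    have h : s ^ (Q ^ 2) * s ^ Q = s * s ^ Q := by
      rw [sq, pow_mul, ← mul_pow, ← pow_succ, ← pow_succ', hs, ht]
    exact mul_right_cancel₀ (pow_ne_zero _ h0) h
  have h3 : ∀ i : ℕ, s ^ (Q ^ 2) ^ i = s := by
    intro i
    induction i with
    | zero => simp
    | succ i ih => rw [pow_succ, pow_mul, ih, h2]
  obtain ⟨i, rfl⟩ := hj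
  rw [pow_succ, pow_succ, pow_mul, pow_mul, h3, ← pow_succ, hs]

variable {F : Type*} [Field F] [Fintype F]

lemma card_filter_pow_eq_one {N : ℕ} (hN : 0 < N) (h : N ∣ Fintype.card F - 1) :
    (Finset.univ.filter fun u : F => u ^ N = 1).card = N := by
  obtain ⟨g, hg⟩ := IsCyclic.exists_generator (α := Fˣ)
  have ho : orderOf g = Fintype.card F - 1 := by
    rw [orderOf_eq_card_of_forall_mem_zpowers hg, Nat.card_eq_fintype_card, Fintype.card_units]
  have hprim : IsPrimitiveRoot (g : F) (Fintype.card F - 1) := by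
    rw [← ho]
    exact (IsPrimitiveRoot.orderOf g).map_of_injective (f := Units.coeHom F) Units.val_injective
  obtain ⟨c, hc⟩ := h
  have hprim' := hprim.pow (Nat.sub_pos_of_lt Fintype.one_lt_card) (hc.trans (mul_comm _ _))
  refine Eq.trans (congrArg Finset.card ?_) hprim'.card_nthRootsFinset
  ext u
  rw [Polynomial.mem_nthRootsFinset hN]
  simp

lemma card_filter_pow_eq_self {N : ℕ} (hN : 1 < N) (h : N - 1 ∣ Fintype.card F - 1) :
    (Finset.univ.filter fun u : F => u ^ N = u).card = N := by
  obtain ⟨N, rfl⟩ : ∃ N', N = N' + 1 := ⟨N - 1, by omega⟩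
  rw [Nat.add_sub_cancel] at h
  have hins : (Finset.univ.filter fun u : F => u ^ (N + 1) = u) =
      insert 0 (Finset.univ.filter fun u : F => u ^ N = 1) := by
    ext u
    rw [Finset.mem_insert, Finset.mem_filter, Finset.mem_filter]
    rcases eq_or_ne u 0 with rfl | hu
    · simp
    · simp [pow_succ, hu]
  rw [hins, Finset.card_insert_of_notMem, card_filter_pow_eq_one (by omega) h]
  simp [zero_pow (show N ≠ 0 by omega)]

lemma exists_pow_eq_of_pow_eq_one {N e : ℕ} (he : 0 < e) (h : N * e ∣ Fintype.card F - 1) {t : F}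
    (ht : t ^ e = 1) : ∃ s : F, s ^ N = t := by
  have ht0 : t ≠ 0 := by
    rintro rfl
    rw [zero_pow he.ne'] at ht
    exact zero_ne_one ht
  obtain ⟨g, hg⟩ := IsCyclic.exists_monoid_generator (α := Fˣ)
  have ho : orderOf g = Fintype.card F - 1 := by
    rw [orderOf_eq_card_of_forall_mem_powers hg, Nat.card_eq_fintype_card, Fintype.card_units]
  obtain ⟨a, ha⟩ := Submonoid.mem_powers_iff _ _ |>.1 (hg (Units.mk0 t ht0))
  have hae : g ^ (a * e) = 1 := by
    rw [pow_mul, ha]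
    ext
    simpa using ht
  have hdvd : N * e ∣ a * e := h.trans (ho ▸ orderOf_dvd_of_pow_eq_one hae)
  obtain ⟨b, rfl⟩ := Nat.dvd_of_mul_dvd_mul_right he hdvd
  refine ⟨((g ^ b : Fˣ) : F), ?_⟩
  rw [← Units.val_pow_eq_pow_val, ← pow_mul, mul_comm b, ha, Units.val_mk0]

lemma card_filter_pow_eq_pow {N : ℕ} (hN : 0 < N) (h : N ∣ Fintype.card F - 1) {y : F}
    (hy : y ≠ 0) : (Finset.univ.filter fun x : F => x ^ N = y ^ N).card = N := by
  refine Eq.trans ?_ (card_filter_pow_eq_one (F := F) hN h)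
  refine Finset.card_bij' (fun x _ => x / y) (fun u _ => u * y) ?_ ?_ ?_ ?_ <;>
    simp +contextual [div_pow, mul_pow, hy]

lemma dvd_card_of_mul_mem {N : ℕ} (hN : 0 < N) (h : N ∣ Fintype.card F - 1) (A : Finset F)
    (h0 : (0 : F) ∉ A) (hA : ∀ u x : F, u ^ N = 1 → x ∈ A → u * x ∈ A) : N ∣ A.card := by
  rw [Finset.card_eq_sum_card_image (fun x => x ^ N) A]
  refine Finset.dvd_sum fun w hw => ?_
  obtain ⟨y, hy, rfl⟩ := Finset.mem_image.1 hw
  have hy0 : y ≠ 0 := fun h => h0 (h ▸ hy)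
  have hfib : (A.filter fun x => x ^ N = y ^ N) = Finset.univ.filter fun x : F => x ^ N = y ^ N := by
    ext x
    simp only [Finset.mem_filter, Finset.mem_univ, true_and, and_iff_right_iff_imp]
    intro hx
    have := hA (x / y) y (by rw [div_pow, hx, div_self (pow_ne_zero _ hy0)]) hy
    rwa [div_mul_cancel₀ _ hy0] at this
  rw [hfib, card_filter_pow_eq_pow hN h hy0]

end FiniteFields

/-- An integer congruent to `1` modulo `p ^ d + 1` whose square is `p ^ (2 * m)` times a small
divisor of `p ^ (2 * m)` is, up to an explicit sign, `p ^ m` times a power of `p ^ d`. -/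
lemma int_eq_of_sq_eq {p d M K : ℕ} (hp : p.Prime) (hp3 : 3 ≤ p) (hM : Odd M) {T : ℤ}
    (hT : T ^ 2 = (p : ℤ) ^ (2 * (d * M)) * K) (hd : 0 < d)
    (hdvd : K ∣ p ^ (2 * (d * M))) (hK : K ≤ p ^ (4 * d)) (hmod : T ≡ 1 [ZMOD (p : ℤ) ^ d + 1]) :
    (T = -(p : ℤ) ^ (d * M) ∧ K = 1) ∨ (T = (p : ℤ) ^ (d * M) * (p : ℤ) ^ d ∧ K = (p ^ d) ^ 2) ∨
      (T = -((p : ℤ) ^ (d * M) * ((p : ℤ) ^ d) ^ 2) ∧ K = (p ^ d) ^ 4) := by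
  obtain ⟨s, -, rfl⟩ := (Nat.dvd_prime_pow hp).1 hdvd
  have hs : s ≤ 4 * d := (Nat.pow_le_pow_iff_right hp.one_lt).1 hK
  have hT' : T.natAbs ^ 2 = p ^ (2 * (d * M) + s) := by
    zify
    rw [sq_abs, hT, pow_add]
    push_cast
    rfl
  obtain ⟨t, -, ht⟩ := (Nat.dvd_prime_pow hp).1 ((Dvd.intro_left _ (sq T.natAbs).symm).trans hT'.dvd)
  rw [ht, ← pow_mul] at hT'
  have hts := Nat.pow_right_injective hp.two_le hT'
  obtain ⟨e, rfl⟩ : ∃ e, t = d * M + e := ⟨t - d * M, by omega⟩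
  obtain rfl : s = 2 * e := by omega
  have hQ : (3 : ℤ) ≤ (p : ℤ) ^ d := by
    have := Nat.pow_le_pow_left hp3 d
    have h3 : 3 ^ 1 ≤ 3 ^ d := Nat.pow_le_pow_right (by norm_num) hd
    exact_mod_cast le_trans h3 this
  have hneg : (p : ℤ) ^ d ≡ -1 [ZMOD (p : ℤ) ^ d + 1] := by
    rw [Int.modEq_iff_dvd]
    exact ⟨-1, by ring⟩
  have hPM : (p : ℤ) ^ (d * M) ≡ -1 [ZMOD (p : ℤ) ^ d + 1] := by
    rw [pow_mul]
    simpa [hM.neg_one_pow] using hneg.pow M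
  have hTe : T = (p : ℤ) ^ (d * M + e) ∨ T = -(p : ℤ) ^ (d * M + e) := by
    have := Int.natAbs_eq T
    rw [ht] at this
    exact_mod_cast this
  have hsmall : ∀ r : ℕ, r < d → ∀ x : ℤ, x ^ 2 = 1 → (p : ℤ) ^ r ≡ x [ZMOD (p : ℤ) ^ d + 1] →
      r = 0 ∧ x = 1 := by
    intro r hr x hx h
    have hlt : (p : ℤ) ^ r < (p : ℤ) ^ d := by exact_mod_cast Nat.pow_lt_pow_right hp.one_lt hr
    have hpos : (1 : ℤ) ≤ (p : ℤ) ^ r := by exact_mod_cast Nat.one_le_pow _ _ hp.pos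
    rw [Int.modEq_iff_dvd] at h
    rcases mul_self_eq_one_iff.1 ((sq x).symm.trans hx) with rfl | rfl
    · have := Int.eq_zero_of_abs_lt_dvd h (by rw [abs_lt]; constructor <;> linarith)
      have h1 : (p : ℤ) ^ r = 1 := by linarith
      have h1' : p ^ r = 1 := by exact_mod_cast h1
      refine ⟨?_, rfl⟩
      by_contra hr0
      exact (Nat.one_lt_pow hr0 hp.one_lt).ne' h1'
    · have := Int.eq_zero_of_abs_lt_dvd h (by rw [abs_lt]; constructor <;> linarith)
      linarith
  have hlarge : ∀ i r : ℕ, e = i * d + r → r < d → ∀ ε : ℤ, ε ^ 2 = 1 →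
      T = ε * (p : ℤ) ^ (d * M + e) → r = 0 ∧ ε = -(-1) ^ i := by
    intro i r he hr ε hε hTε
    have h : T ≡ ε * (-1 * ((-1) ^ i * (p : ℤ) ^ r)) [ZMOD (p : ℤ) ^ d + 1] := by
      rw [hTε, he, pow_add, pow_add, mul_comm i, pow_mul _ d i]
      exact (hPM.mul ((hneg.pow i).mul_right _)).mul_left _
    have h' := (hmod.symm.trans h).mul_left (ε * (-1 * (-1) ^ i))
    have hi : ((-1 : ℤ) ^ i) ^ 2 = 1 := by rw [← pow_mul, mul_comm, pow_mul]; simp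
    have h2 := hsmall r hr (ε * (-1 * (-1) ^ i)) (by linear_combination hε * ((-1) ^ i) ^ 2 + hi) (by
      convert h'.symm using 1
      · linear_combination (-((-1) ^ i) ^ 2 * (p : ℤ) ^ r) * hε - (p : ℤ) ^ r * hi
      · ring)
    refine ⟨h2.1, ?_⟩
    linear_combination (-(-1) ^ i) * h2.2 - ε * hi
  have hcases : ∃ i r, e = i * d + r ∧ r < d ∧ i ≤ 2 := by
    refine ⟨e / d, e % d, ?_, Nat.mod_lt _ hd, ?_⟩
    · rw [mul_comm]; exact (Nat.div_add_mod e d).symm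
    · exact Nat.div_le_of_le_mul (by omega)
  obtain ⟨i, r, he, hr, hi⟩ := hcases
  obtain ⟨ε, hε, hTε⟩ : ∃ ε : ℤ, ε ^ 2 = 1 ∧ T = ε * (p : ℤ) ^ (d * M + e) := by
    rcases hTe with h | h
    · exact ⟨1, by norm_num, by rw [h, one_mul]⟩
    · exact ⟨-1, by norm_num, by rw [h, neg_one_mul]⟩
  obtain ⟨rfl, hεi⟩ := hlarge i r he hr ε hε hTε
  rw [hTε, hεi, he]
  interval_cases i
  · left; simp
  · right; left
    constructor
    · rw [pow_add]; ring
    · rw [← pow_mul]; congr 1; ring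
  · right; right
    constructor
    · rw [pow_add, ← pow_mul]; ring
    · rw [← pow_mul]; congr 1; ring

section HermitianForm

variable {p m n k d : ℕ} [Fact p.Prime] {F : Type} [Field F] [Fintype F] [Algebra (ZMod p) F]

/-- The absolute trace as an additive map. -/
abbrev traceHom (p : ℕ) (F : Type) [Field F] [Algebra (ZMod p) F] : F →+ ZMod p :=
  (Algebra.trace (ZMod p) F).toAddMonoidHom

omit [Fintype F] in
lemma charP_of_algebra_zmod (p : ℕ) (F : Type) [Fact p.Prime] [Field F] [Algebra (ZMod p) F] :
    CharP F p :=
  charP_of_injective_algebraMap (algebraMap (ZMod p) F).injective p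

lemma traceHom_pow (j : ℕ) (x : F) : traceHom p F (x ^ p ^ j) = traceHom p F x := by
  induction j with
  | zero => simp
  | succ j ih =>
    rw [pow_succ, pow_mul, ← ih]
    have h := Algebra.trace_eq_of_algEquiv
      (FiniteField.frobeniusAlgEquivOfAlgebraic (ZMod p) F) (x ^ p ^ j)
    simpa [ZMod.card] using h

lemma traceHom_nondeg (c : F) (h : ∀ x, traceHom p F (x * c) = 0) : c = 0 := by
  have htr := (traceForm_nondegenerate (ZMod p) F).1 c
  simp_rw [Algebra.traceForm_apply] at htr
  exact htr fun x => by rw [mul_comm]; exact h x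

lemma finrank_zmod_eq (hF : Fintype.card F = p ^ n) : Module.finrank (ZMod p) F = n := by
  have h := Module.card_eq_pow_finrank (K := ZMod p) (V := F)
  rw [hF, ZMod.card] at h
  exact (Nat.pow_right_injective (Fact.out : p.Prime).two_le h).symm

lemma trSum_eq_trace (hF : Fintype.card F = p ^ n) (x : F) :
    trSum p 1 n x = algebraMap (ZMod p) F (traceHom p F x) := by
  have h := FiniteField.algebraMap_trace_eq_sum_pow (ZMod p) F x
  rw [finrank_zmod_eq hF, Nat.card_zmod] at h
  simpa [trSum] using h.symm

omit [Fintype F] in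
lemma fToZMod_algebraMap (a : ZMod p) : fToZMod p (algebraMap (ZMod p) F a) = a :=
  Function.leftInverse_invFun (algebraMap (ZMod p) F).injective a

variable (F) in
omit [Fintype F] in
lemma two_ne_zero_of_odd (hp : p ≠ 2) : (2 : F) ≠ 0 := by
  have := charP_of_algebra_zmod p F
  intro h
  have h2 : ((2 : ℕ) : F) = 0 := by exact_mod_cast h
  rw [CharP.cast_eq_zero_iff F p, Nat.prime_dvd_prime_iff_eq Fact.out Nat.prime_two] at h2
  exact hp h2

lemma trSum_half_eq_trace (hp : p ≠ 2) (hF : Fintype.card F = p ^ (2 * m)) {z : F}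
    (hz : z ^ p ^ m = z) : trSum p 1 m z = algebraMap (ZMod p) F (traceHom p F (z / 2)) := by
  have := charP_of_algebra_zmod p F
  have h2 := two_ne_zero_of_odd F hp
  have h2p : ∀ j, (2 : F) ^ p ^ j = 2 := by
    intro j
    have h := add_pow_char_pow (1 : F) 1 (p := p) (n := j)
    rwa [one_pow, one_add_one_eq_two] at h
  rw [← trSum_eq_trace hF, trSum, trSum, two_mul, Finset.sum_range_add, ← Finset.sum_add_distrib]
  refine Finset.sum_congr rfl fun i _ => ?_
  have h : (z / 2) ^ p ^ (1 * (m + i)) = (z / 2) ^ p ^ (1 * i) := by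
    rw [one_mul, one_mul, pow_add, pow_mul, div_pow, h2p, hz]
  rw [h, div_pow, h2p]
  field_simp
  ring

lemma expChar_eq_stdAddChar (c : ZMod p) : expChar p c = ZMod.stdAddChar c := by
  rw [ZMod.stdAddChar_apply, ZMod.toCircle_apply, expChar]

/-- The quadratic form `x ↦ Tr(α x^{p^m+1} / 2 + β x^{p^k+1})`. -/
def traceForm (p m k : ℕ) {F : Type} [Field F] [Algebra (ZMod p) F] (α β x : F) : ZMod p :=
  traceHom p F (α / 2 * x ^ (p ^ m + 1) + β * x ^ (p ^ k + 1))

/-- `phiMap` as an additive map. -/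
def phiHom (p m n k : ℕ) {F : Type} [Field F] [CharP F p] [Fact p.Prime] (α β : F) : F →+ F where
  toFun := phiMap p m n k α β
  map_zero' := by
    have h : ∀ j, p ^ j ≠ 0 := fun j => pow_ne_zero _ (Fact.out : p.Prime).ne_zero
    simp [phiMap, zero_pow (h _)]
  map_add' x y := by
    simp only [phiMap, add_pow_char_pow]
    ring

omit [Fact p.Prime] [Algebra (ZMod p) F] in
lemma pow_pow_add_one_mem (hF : Fintype.card F = p ^ (2 * m)) (x : F) :
    (x ^ (p ^ m + 1)) ^ p ^ m = x ^ (p ^ m + 1) := by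
  have h : x ^ p ^ (2 * m) = x := by rw [← hF, FiniteField.pow_card]
  rw [← pow_mul, add_mul, ← pow_add, ← two_mul, one_mul, pow_add, h, pow_succ']

lemma Ssum_eq_twistedSum (hp : p ≠ 2) (hn : n = 2 * m) (hF : Fintype.card F = p ^ n) {α : F}
    (hα : α ^ p ^ m = α) (β γ : F) :
    Ssum p m n k F α β γ = twistedSum (traceHom p F) (traceForm p m k α β) γ := by
  refine Finset.sum_congr rfl fun x _ => ?_
  have hz : (α * x ^ (p ^ m + 1)) ^ p ^ m = α * x ^ (p ^ m + 1) := by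
    rw [mul_pow, hα, pow_pow_add_one_mem (hn ▸ hF)]
  rw [expChar_eq_stdAddChar, trSum_half_eq_trace hp (hn ▸ hF) hz, trSum_eq_trace hF,
    fToZMod_algebraMap, fToZMod_algebraMap, traceForm, ← map_add, ← map_add]
  congr 2
  ring

lemma traceForm_add [CharP F p] (hp : p ≠ 2) (hn : n = 2 * m) (hk : k ≤ n)
    (hF : Fintype.card F = p ^ n) {α : F} (hα : α ^ p ^ m = α) (β x y : F) :
    traceForm p m k α β (x + y) = traceForm p m k α β x + traceForm p m k α β y +
      traceHom p F (x * phiHom p m n k α β y) := by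
  have hq : ∀ x : F, x ^ p ^ n = x := fun x => by rw [← hF, FiniteField.pow_card]
  have h2 := two_ne_zero_of_odd F hp
  have h2p : (2 : F) ^ p ^ m = 2 := by
    have h := add_pow_char_pow (1 : F) 1 (p := p) (n := m)
    rwa [one_pow, one_add_one_eq_two] at h
  have h1 : traceHom p F (α / 2 * x ^ p ^ m * y) = traceHom p F (α / 2 * x * y ^ p ^ m) := by
    rw [← traceHom_pow m, mul_pow, mul_pow, div_pow, h2p, hα, ← pow_mul, ← pow_add, ← two_mul, ← hn,
      hq]
  have h3 : traceHom p F (β * x ^ p ^ k * y) =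
      traceHom p F (x * (β ^ p ^ (n - k) * y ^ p ^ (n - k))) := by
    rw [← traceHom_pow (n - k), mul_pow, mul_pow, ← pow_mul, ← pow_add, Nat.add_sub_cancel' hk, hq]
    congr 1
    ring
  have hsplit : traceHom p F (x * phiHom p m n k α β y) =
      traceHom p F (α / 2 * x * y ^ p ^ m) + traceHom p F (α / 2 * x * y ^ p ^ m) +
        traceHom p F (β * x * y ^ p ^ k) +
        traceHom p F (x * (β ^ p ^ (n - k) * y ^ p ^ (n - k))) := by
    rw [← map_add, ← map_add, ← map_add]
    congr 1
    change x * phiMap p m n k α β y = _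
    rw [phiMap]
    field_simp
    ring
  rw [hsplit, ← h3]
  nth_rewrite 1 [← h1]
  simp only [traceForm, ← map_add]
  congr 1
  simp only [pow_succ, add_pow_char_pow]
  ring

/-- Numerical hypotheses under which `traceForm` is the trace of a Hermitian form
over the extension of degree `2` of the field with `p ^ d` elements. -/
structure IsHermitianCase (p m n k d : ℕ) : Prop where
  ne_two : p ≠ 2
  d_pos : 0 < d
  n_eq : n = 2 * m
  k_le : k ≤ n
  m_odd : ∃ M, m = d * M ∧ Odd M
  k_odd : ∃ K, k = d * K ∧ Odd K
  gcd_add : Nat.gcd (m + k) n = 2 * d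
  gcd_two : Nat.gcd (2 * k) n = 2 * d

namespace IsHermitianCase

variable (H : IsHermitianCase p m n k d) (hF : Fintype.card F = p ^ n)
include H

omit [Fact p.Prime] in
lemma two_mul_dvd : 2 * d ∣ n := H.gcd_two ▸ Nat.gcd_dvd_right _ _

omit [Fact p.Prime] [Algebra (ZMod p) F] in
include hF in
omit [Field F] H in
lemma sub_one_dvd {r : ℕ} (hr : r ∣ n) : p ^ r - 1 ∣ Fintype.card F - 1 :=
  hF ▸ Nat.pow_sub_one_dvd_pow_sub_one p hr

omit [Fact p.Prime] [Algebra (ZMod p) F] in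
include hF in
omit [Field F] in
lemma mul_sub_one_dvd : (p ^ d + 1) * (p ^ d - 1) ∣ Fintype.card F - 1 := by
  have h := sub_one_dvd hF H.two_mul_dvd
  rwa [mul_comm 2, pow_mul, show (p ^ d) ^ 2 - 1 = (p ^ d + 1) * (p ^ d - 1) from
    Nat.sq_sub_sq (p ^ d) 1] at h

omit [Fact p.Prime] [Algebra (ZMod p) F] in
include hF in
omit [Field F] in
lemma add_one_dvd : p ^ d + 1 ∣ Fintype.card F - 1 :=
  (dvd_mul_right _ _).trans (H.mul_sub_one_dvd hF)

omit [Fact p.Prime] [Fintype F] [Algebra (ZMod p) F] in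
lemma pow_eq_of_pow_eq {s t : F} (hs : s ^ (p ^ d + 1) = t) (ht : t ^ p ^ d = t) :
    s ^ (p ^ m + 1) = t ∧ s ^ (p ^ k + 1) = t := by
  obtain ⟨M, hM, hM'⟩ := H.m_odd
  obtain ⟨K, hK, hK'⟩ := H.k_odd
  exact ⟨by rw [hM, pow_mul]; exact pow_odd_pow_add_one hs ht hM',
    by rw [hK, pow_mul]; exact pow_odd_pow_add_one hs ht hK'⟩

omit [Fintype F] in
lemma traceForm_smul {s : F} {t : ZMod p}
    (hs : s ^ (p ^ d + 1) = algebraMap (ZMod p) F t) (α β x : F) :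
    traceForm p m k α β (s * x) = t * traceForm p m k α β x := by
  obtain ⟨h1, h2⟩ := H.pow_eq_of_pow_eq hs (by rw [← map_pow, ZMod.pow_card_pow])
  have h : α / 2 * (s * x) ^ (p ^ m + 1) + β * (s * x) ^ (p ^ k + 1) =
      t • (α / 2 * x ^ (p ^ m + 1) + β * x ^ (p ^ k + 1)) := by
    rw [mul_pow, mul_pow, h1, h2, Algebra.smul_def]
    ring
  simp only [traceForm]
  rw [h]
  exact map_smul (Algebra.trace (ZMod p) F) t _

include hF in
lemma isScalableForm [CharP F p] {α : F} (hα : α ^ p ^ m = α) (β : F) :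
    IsScalableForm (traceHom p F) (traceForm p m k α β) (phiHom p m n k α β) where
  nondeg := traceHom_nondeg
  polar := traceForm_add H.ne_two H.n_eq H.k_le hF hα β
  even x := by
    have hpo : Odd p := (Fact.out : p.Prime).odd_of_ne_two H.ne_two
    have h : ∀ j, (-x) ^ (p ^ j + 1) = x ^ (p ^ j + 1) := fun j => (hpo.pow.add_odd odd_one).neg_pow x
    simp only [traceForm, h]
  scale t ht := by
    have hp := (Fact.out : p.Prime)
    obtain ⟨s, hs⟩ : ∃ s : F, s ^ (p ^ d + 1) = algebraMap (ZMod p) F t := by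
      refine exists_pow_eq_of_pow_eq_one
        (Nat.sub_pos_of_lt (Nat.one_lt_pow H.d_pos.ne' hp.one_lt)) (H.mul_sub_one_dvd hF) ?_
      obtain ⟨c, hc⟩ : p - 1 ∣ p ^ d - 1 := by simpa using Nat.sub_dvd_pow_sub_pow p 1 d
      rw [hc, ← map_pow, pow_mul, ZMod.pow_card_sub_one_eq_one ht, one_pow, map_one]
    refine ⟨s, ?_, H.traceForm_smul hs α β⟩
    rintro rfl
    rw [zero_pow (Nat.succ_ne_zero _), eq_comm, map_eq_zero] at hs
    exact ht hs

include hF in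
lemma card_fixed_le : (Finset.univ.filter fun x : F => x ^ p ^ (m + k) = x).card ≤ p ^ (2 * d) := by
  have := charP_of_algebra_zmod p F
  have hp := (Fact.out : p.Prime)
  have h := card_filter_pow_eq_self (F := F)
    (Nat.one_lt_pow (Nat.mul_ne_zero two_ne_zero H.d_pos.ne') hp.one_lt)
    (sub_one_dvd hF H.two_mul_dvd)
  rw [← h]
  refine Finset.card_le_card fun x hx => ?_
  rw [Finset.mem_filter] at hx ⊢
  refine ⟨hx.1, ?_⟩
  rw [← H.gcd_add]
  exact pow_expChar_gcd p hx.2 (by rw [← hF, FiniteField.pow_card])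

include hF in
lemma card_ker_le [CharP F p] {α β : F} (h0 : ¬ (α = 0 ∧ β = 0)) :
    (Finset.univ.filter fun x => phiHom p m n k α β x = 0).card ≤ p ^ (4 * d) := by
  have hp := (Fact.out : p.Prime)
  have hq : ∀ x : F, x ^ p ^ n = x := fun x => by rw [← hF, FiniteField.pow_card]
  set τ : F →+* F := iterateFrobenius F p (m + k) with hτ
  have hτ_apply : ∀ x, τ x = x ^ p ^ (m + k) := fun x => iterateFrobenius_def p (m + k) x
  have hker : ∀ x, phiHom p m n k α β x = 0 →
      α ^ p ^ k * τ x + β ^ p ^ k * τ (τ x) + β * x = 0 := by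
    intro x hx
    have h1 : (phiMap p m n k α β x) ^ p ^ k = 0 := by
      change phiMap p m n k α β x = 0 at hx
      rw [hx, zero_pow (pow_ne_zero _ hp.ne_zero)]
    have h2 : τ (τ x) = x ^ p ^ (k + k) := by
      rw [hτ_apply, hτ_apply, ← pow_mul, ← pow_add,
        show m + k + (m + k) = n + (k + k) by rw [H.n_eq]; ring, pow_add _ n, pow_mul, hq]
    rw [phiMap, add_pow_char_pow, add_pow_char_pow, mul_pow, mul_pow, mul_pow, ← pow_mul, ← pow_mul,
      ← pow_mul, ← pow_mul, ← pow_add, ← pow_add, ← pow_add, Nat.sub_add_cancel H.k_le, hq, hq] at h1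
    rwa [h2, hτ_apply x]
  by_cases hβ : β = 0
  · have hα : α ^ p ^ k ≠ 0 := pow_ne_zero _ fun h => h0 ⟨h, hβ⟩
    have hz : (Finset.univ.filter fun x => phiHom p m n k α β x = 0) ⊆ {0} := by
      intro x hx
      have h := hker x (Finset.mem_filter.1 hx).2
      rw [hβ, zero_pow (pow_ne_zero _ hp.ne_zero), zero_mul, zero_mul, add_zero, add_zero] at h
      rw [Finset.mem_singleton, ← map_eq_zero τ]
      exact (mul_eq_zero.1 h).resolve_left hα
    exact (Finset.card_le_card hz).trans (Nat.one_le_pow _ _ hp.pos)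
  have hb : β ^ p ^ k ≠ 0 := pow_ne_zero _ hβ
  set fixed := Finset.univ.filter fun x : F => x ^ p ^ (m + k) = x with hfixed
  have hfix : fixed.card ≤ p ^ (2 * d) := H.card_fixed_le hF
  have hmem : ∀ x, x ∈ fixed ↔ τ x = x := fun x => by simp [hfixed, hτ_apply]
  by_cases hall : ∀ x, phiHom p m n k α β x = 0 → x = 0
  · have hz : (Finset.univ.filter fun x => phiHom p m n k α β x = 0) ⊆ {0} := by
      intro x hx
      exact Finset.mem_singleton.2 (hall x (Finset.mem_filter.1 hx).2)
    exact (Finset.card_le_card hz).trans (Nat.one_le_pow _ _ hp.pos)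
  push Not at hall
  obtain ⟨x₀, hx₀, hx₀'⟩ := hall
  have hτ₀ : τ x₀ ≠ 0 := by rwa [Ne, map_eq_zero]
  set w : F → F := fun x => x * τ x₀ - x₀ * τ x with hw
  have himg : ((Finset.univ.filter fun x => phiHom p m n k α β x = 0).image w).card ≤ fixed.card := by
    have hrel : ∀ y ∈ (Finset.univ.filter fun x => phiHom p m n k α β x = 0).image w,
        β ^ p ^ k * τ y = β * y := by
      intro y hy
      obtain ⟨x, hx, rfl⟩ := Finset.mem_image.1 hy
      have e1 := hker x (Finset.mem_filter.1 hx).2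
      have e0 := hker x₀ hx₀
      simp only [hw, map_sub, map_mul]
      linear_combination τ x * e0 - τ x₀ * e1
    by_cases hW : ∃ y₀ ∈ (Finset.univ.filter fun x => phiHom p m n k α β x = 0).image w, y₀ ≠ 0
    · obtain ⟨y₀, hy₀, hy₀'⟩ := hW
      have hτy : τ y₀ ≠ 0 := by rwa [Ne, map_eq_zero]
      refine Finset.card_le_card_of_injOn (fun y => y / y₀) ?_ ?_
      · intro y hy
        rw [Finset.mem_coe, hmem, map_div₀, div_eq_div_iff hτy hy₀']
        refine mul_left_cancel₀ hb ?_
        linear_combination y₀ * hrel y hy - y * hrel y₀ hy₀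
      · intro y _ y' _ h
        exact (div_left_inj' hy₀').1 h
    · push Not at hW
      have : (Finset.univ.filter fun x => phiHom p m n k α β x = 0).image w ⊆ {0} :=
        fun y hy => Finset.mem_singleton.2 (hW y hy)
      refine (Finset.card_le_card this).trans (Finset.card_pos.2 ⟨0, ?_⟩)
      rw [hmem, map_zero]
  have hfib : ∀ y ∈ (Finset.univ.filter fun x => phiHom p m n k α β x = 0).image w,
      ((Finset.univ.filter fun x => phiHom p m n k α β x = 0).filter fun x => w x = y).card ≤
        fixed.card := by
    intro y hy
    obtain ⟨x₁, -, rfl⟩ := Finset.mem_image.1 hy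
    refine Finset.card_le_card_of_injOn (fun x => (x - x₁) / x₀) ?_ ?_
    · intro x hx
      have h : w x = w x₁ := (Finset.mem_filter.1 hx).2
      simp only [hw] at h
      rw [Finset.mem_coe, hmem, map_div₀, div_eq_div_iff hτ₀ hx₀', map_sub]
      linear_combination -h
    · intro y _ y' _ h
      exact sub_left_injective ((div_left_inj' hx₀').1 h)
  calc (Finset.univ.filter fun x => phiHom p m n k α β x = 0).card
      ≤ fixed.card * _ := Finset.card_le_mul_card_image _ _ hfib
    _ ≤ p ^ (2 * d) * p ^ (2 * d) := Nat.mul_le_mul hfix (himg.trans hfix)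
    _ = p ^ (4 * d) := by rw [← pow_add]; congr 1; ring

end IsHermitianCase

end HermitianForm

section Moments

namespace IsHermitianCase

variable {p m n k d : ℕ} [Fact p.Prime] {F : Type} [Field F] [Fintype F] [Algebra (ZMod p) F]

/-- The elements of the subfield with `p ^ m` elements. -/
def subfieldFinset (p m : ℕ) (F : Type) [Field F] [Fintype F] : Finset F :=
  Finset.univ.filter fun α => α ^ p ^ m = α

/-- The exponential sum `∑ x, ζ ^ Tr(α x^{p^m+1} / 2 + β x^{p^k+1})` of a pair `(α, β)`. -/
abbrev pairSum (p m k : ℕ) [Fact p.Prime] {F : Type} [Field F] [Fintype F] [Algebra (ZMod p) F]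
    (ab : F × F) : ℂ :=
  twistedSum (traceHom p F) (traceForm p m k ab.1 ab.2) 0

omit [Fact p.Prime] [Algebra (ZMod p) F] in
lemma mem_subfieldFinset {α : F} : α ∈ subfieldFinset p m F ↔ α ^ p ^ m = α := by
  simp [subfieldFinset]

variable (H : IsHermitianCase p m n k d) (hF : Fintype.card F = p ^ n)
include H

omit [Algebra (ZMod p) F] in
include hF in
lemma card_subfieldFinset (hm : 0 < m) : (subfieldFinset p m F).card = p ^ m :=
  card_filter_pow_eq_self (Nat.one_lt_pow hm.ne' (Fact.out : p.Prime).one_lt)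
    (sub_one_dvd hF (H.n_eq ▸ dvd_mul_left _ _))

include hF in
lemma sum_subfieldFinset (hm : 0 < m) {u : F} (hu : u ^ p ^ m = u) :
    ∑ α ∈ subfieldFinset p m F, (ZMod.stdAddChar (traceHom p F (α / 2 * u)) : ℂ) =
      if u = 0 then (p : ℂ) ^ m else 0 := by
  have := charP_of_algebra_zmod p F
  have hp := (Fact.out : p.Prime)
  split_ifs with hu0
  · simp [hu0, H.card_subfieldFinset hF hm]
  have h2 := two_ne_zero_of_odd F H.ne_two
  have : NeZero (2 : F) := ⟨h2⟩
  have h2p : (2 : F) ^ p ^ m = 2 := by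
    have h := add_pow_char_pow (1 : F) 1 (p := p) (n := m)
    rwa [one_pow, one_add_one_eq_two] at h
  let A : AddSubgroup F :=
    { carrier := {α | α ^ p ^ m = α}
      zero_mem' := zero_pow (pow_ne_zero _ hp.ne_zero)
      add_mem' := fun {a b} ha hb => by
        simp only [Set.mem_ofPred_eq] at ha hb ⊢
        rw [add_pow_char_pow, ha, hb]
      neg_mem' := fun {a} ha => by
        simp only [Set.mem_ofPred_eq] at ha ⊢
        rw [((hp.odd_of_ne_two H.ne_two).pow).neg_pow, ha] }
  let φ : A →+ ZMod p := ((traceHom p F).comp (AddMonoidHom.mulRight (u / 2))).comp A.subtype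
  have hφ : φ ≠ 0 := by
    intro h0
    refine hu0 (traceHom_nondeg (p := p) u fun z => ?_)
    have hz : z + z ^ p ^ m ∈ A := by
      change (z + z ^ p ^ m) ^ p ^ m = z + z ^ p ^ m
      rw [add_pow_char_pow, ← pow_mul, ← pow_add, ← two_mul, ← H.n_eq, ← hF, FiniteField.pow_card,
        add_comm]
    have h := DFunLike.congr_fun h0 ⟨_, hz⟩
    change traceHom p F ((z + z ^ p ^ m) * (u / 2)) = 0 at h
    have hsplit : (z + z ^ p ^ m) * (u / 2) = z * (u / 2) + (z * (u / 2)) ^ p ^ m := by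
      rw [mul_pow, div_pow, hu, h2p, add_mul]
    rw [hsplit, map_add, traceHom_pow, ← map_add, ← mul_add, add_halves] at h
    exact h
  have h := sum_stdAddChar_comp φ
  rw [if_neg hφ] at h
  rw [← h]
  refine Eq.trans (Finset.sum_subtype (p := fun x => x ∈ A) _ (fun x => mem_subfieldFinset) _)
    (Finset.sum_congr rfl fun a _ => ?_)
  change _ = ZMod.stdAddChar (traceHom p F ((a : F) * (u / 2)))
  congr 2
  ring

include hF in
lemma sum_pairs (hm : 0 < m) {u : F} (hu : u ^ p ^ m = u) (v : F) :
    ∑ ab ∈ subfieldFinset p m F ×ˢ Finset.univ,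
      (ZMod.stdAddChar (traceHom p F (ab.1 / 2 * u + ab.2 * v)) : ℂ) =
      if u = 0 ∧ v = 0 then (p : ℂ) ^ m * p ^ n else 0 := by
  rw [Finset.sum_product]
  have h : ∀ α β : F, (ZMod.stdAddChar (traceHom p F (α / 2 * u + β * v)) : ℂ) =
      ZMod.stdAddChar (traceHom p F (α / 2 * u)) * ZMod.stdAddChar (traceHom p F (β * v)) := by
    intro α β
    rw [map_add, AddChar.map_add_eq_mul]
  simp only [h]
  rw [← Finset.sum_mul_sum, H.sum_subfieldFinset hF hm hu, sum_stdAddChar_mul traceHom_nondeg, hF]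
  split_ifs <;> simp_all

include hF in
lemma sum_pairSum (hm : 0 < m) :
    ∑ ab ∈ subfieldFinset p m F ×ˢ Finset.univ, pairSum p m k ab = (p : ℂ) ^ m * p ^ n := by
  simp only [pairSum, twistedSum, traceForm, zero_mul, map_zero, add_zero]
  rw [Finset.sum_comm]
  have h := fun x : F =>
    H.sum_pairs hF hm (pow_pow_add_one_mem (m := m) (H.n_eq ▸ hF) x) (x ^ (p ^ k + 1))
  simp only [h]
  simp

include hF in
lemma pow_eq_pow_iff (x y : F) :
    (x ^ (p ^ m + 1) = y ^ (p ^ m + 1) ∧ x ^ (p ^ k + 1) = y ^ (p ^ k + 1)) ↔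
      x ^ (p ^ d + 1) = y ^ (p ^ d + 1) := by
  have := charP_of_algebra_zmod p F
  rcases eq_or_ne y 0 with rfl | hy
  · simp
  have hdiv : ∀ j, x ^ j = y ^ j ↔ (x / y) ^ j = 1 := fun j => by
    rw [div_pow, div_eq_one_iff_eq (pow_ne_zero _ hy)]
  rw [hdiv, hdiv, hdiv]
  generalize x / y = z
  refine ⟨fun ⟨h1, h2⟩ => ?_, fun h => H.pow_eq_of_pow_eq h (one_pow _)⟩
  have hz0 : z ≠ 0 := by
    rintro rfl
    rw [zero_pow (Nat.succ_ne_zero _)] at h1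
    exact zero_ne_one h1
  have hz2k : z ^ p ^ (2 * k) = z := by
    have h3 : z ^ p ^ (2 * k) * z ^ p ^ k = z * z ^ p ^ k := by
      rw [two_mul, pow_add, pow_mul, ← mul_pow, ← pow_succ, ← pow_succ', h2, one_pow]
    exact mul_right_cancel₀ (pow_ne_zero _ hz0) h3
  have hz2d : z ^ p ^ (2 * d) = z := by
    rw [← H.gcd_two]
    exact pow_expChar_gcd p hz2k (by rw [← hF, FiniteField.pow_card])
  obtain ⟨M, hM, i, rfl⟩ := H.m_odd
  have hi : ∀ i, z ^ p ^ (2 * d * i) = z := by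
    intro i
    induction i with
    | zero => simp
    | succ i ih => rw [mul_add, mul_one, pow_add, pow_mul, ih, hz2d]
  rw [hM, show d * (2 * i + 1) = 2 * d * i + d by ring, pow_add p, pow_succ, pow_mul, hi i,
    ← pow_succ] at h1
  exact h1

include hF in
lemma card_pow_eq_pow : (Finset.univ.filter fun xy : F × F =>
      xy.1 ^ (p ^ m + 1) = xy.2 ^ (p ^ m + 1) ∧ xy.1 ^ (p ^ k + 1) = xy.2 ^ (p ^ k + 1)).card =
    1 + (p ^ n - 1) * (p ^ d + 1) := by
  simp only [H.pow_eq_pow_iff hF]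
  rw [Finset.card_filter, Fintype.sum_prod_type_right]
  simp only [← Finset.card_filter]
  rw [← Finset.add_sum_erase _ _ (Finset.mem_univ (0 : F))]
  congr 1
  · rw [Finset.card_eq_one]
    exact ⟨0, by ext x; simp⟩
  · rw [Finset.sum_const_nat fun y hy =>
      card_filter_pow_eq_pow (Nat.succ_pos _) (H.add_one_dvd hF) (Finset.ne_of_mem_erase hy)]
    rw [Finset.card_erase_of_mem (Finset.mem_univ _), Finset.card_univ, hF]

include hF in
lemma sum_pairSum_mul_conj (hm : 0 < m) :
    ∑ ab ∈ subfieldFinset p m F ×ˢ Finset.univ,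
      pairSum p m k ab * (starRingEnd ℂ) (pairSum p m k ab) =
      (p : ℂ) ^ m * p ^ n * (1 + ((p : ℂ) ^ n - 1) * ((p : ℂ) ^ d + 1)) := by
  have := charP_of_algebra_zmod p F
  have hp := (Fact.out : p.Prime)
  have h1 : ∀ ab : F × F, pairSum p m k ab * (starRingEnd ℂ) (pairSum p m k ab) =
      ∑ xy : F × F, (ZMod.stdAddChar (traceHom p F
        (ab.1 / 2 * (xy.1 ^ (p ^ m + 1) - xy.2 ^ (p ^ m + 1)) +
          ab.2 * (xy.1 ^ (p ^ k + 1) - xy.2 ^ (p ^ k + 1)))) : ℂ) := by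
    intro ab
    rw [Fintype.sum_prod_type]
    simp only [pairSum, twistedSum, traceForm, zero_mul, map_zero, add_zero]
    rw [map_sum, Finset.sum_mul_sum]
    refine Finset.sum_congr rfl fun x _ => Finset.sum_congr rfl fun y _ => ?_
    rw [conj_stdAddChar, ← AddChar.map_add_eq_mul, ← map_neg, ← map_add]
    congr 2
    ring
  have h2 : ∀ xy : F × F, ∑ ab ∈ subfieldFinset p m F ×ˢ Finset.univ, (ZMod.stdAddChar (traceHom p F
        (ab.1 / 2 * (xy.1 ^ (p ^ m + 1) - xy.2 ^ (p ^ m + 1)) +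
          ab.2 * (xy.1 ^ (p ^ k + 1) - xy.2 ^ (p ^ k + 1)))) : ℂ) =
      if xy.1 ^ (p ^ m + 1) = xy.2 ^ (p ^ m + 1) ∧ xy.1 ^ (p ^ k + 1) = xy.2 ^ (p ^ k + 1) then
        (p : ℂ) ^ m * p ^ n else 0 := by
    intro xy
    have hu : (xy.1 ^ (p ^ m + 1) - xy.2 ^ (p ^ m + 1)) ^ p ^ m =
        xy.1 ^ (p ^ m + 1) - xy.2 ^ (p ^ m + 1) := by
      rw [sub_pow_char_pow, pow_pow_add_one_mem (H.n_eq ▸ hF), pow_pow_add_one_mem (H.n_eq ▸ hF)]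
    rw [H.sum_pairs hF hm hu]
    simp only [sub_eq_zero]
  simp only [h1]
  rw [Finset.sum_comm]
  simp only [h2]
  rw [← Finset.sum_filter, Finset.sum_const, H.card_pow_eq_pow hF, nsmul_eq_mul]
  push_cast [Nat.one_le_pow n p hp.pos]
  ring

include hF in
lemma pairSum_cases [CharP F p] {ab : F × F} (hα : ab.1 ^ p ^ m = ab.1) (h0 : ab ≠ 0) :
    (pairSum p m k ab = -(p : ℂ) ^ m ∧
      (Finset.univ.filter fun x => phiHom p m n k ab.1 ab.2 x = 0).card = 1) ∨
    (pairSum p m k ab = (p : ℂ) ^ m * (p : ℂ) ^ d ∧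
      (Finset.univ.filter fun x => phiHom p m n k ab.1 ab.2 x = 0).card = (p ^ d) ^ 2) ∨
    (pairSum p m k ab = -((p : ℂ) ^ m * ((p : ℂ) ^ d) ^ 2) ∧
      (Finset.univ.filter fun x => phiHom p m n k ab.1 ab.2 x = 0).card = (p ^ d) ^ 4) := by
  have hp := (Fact.out : p.Prime)
  have hf := H.isScalableForm hF hα ab.2
  set T : ℤ := Fintype.card F -
    p * (Finset.univ.filter fun y => traceForm p m k ab.1 ab.2 y = 1).card with hT
  have hTint : pairSum p m k ab = (T : ℂ) := hf.twistedSum_zero_eq_int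
  set K := (Finset.univ.filter fun x => phiHom p m n k ab.1 ab.2 x = 0).card with hK
  obtain ⟨M, hM, hM'⟩ := H.m_odd
  have hn : n = 2 * (d * M) := by rw [H.n_eq, hM]
  have hsq : T ^ 2 = (p : ℤ) ^ (2 * (d * M)) * K := by
    have h := hf.twistedSum_zero_mul_conj H.ne_two
    change pairSum p m k ab * (starRingEnd ℂ) (pairSum p m k ab) = _ at h
    rw [hTint, map_intCast, hF, ← hK, hn] at h
    rw [sq]
    exact_mod_cast h
  have hdvd : K ∣ p ^ (2 * (d * M)) := by
    rw [← hn, ← hF]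
    exact Dvd.intro_left _ (IsScalableForm.card_image_mul_card_ker _)
  have hKle : K ≤ p ^ (4 * d) := H.card_ker_le hF fun h => h0 (Prod.ext h.1 h.2)
  have hmod : T ≡ 1 [ZMOD (p : ℤ) ^ d + 1] := by
    have h1 : p ^ d + 1 ∣ (Finset.univ.filter fun y => traceForm p m k ab.1 ab.2 y = 1).card := by
      refine dvd_card_of_mul_mem (Nat.succ_pos _) (H.add_one_dvd hF) _ ?_ ?_
      · simp [hf.map_zero]
      · intro u x hu hx
        rw [Finset.mem_filter] at hx ⊢
        refine ⟨Finset.mem_univ _, ?_⟩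
        rw [H.traceForm_smul (t := 1) (by rw [hu, map_one]), hx.2, one_mul]
    have h2 : (p : ℤ) ^ d + 1 ∣ (Fintype.card F : ℤ) - 1 := by
      have h := Int.natCast_dvd_natCast.2 (H.add_one_dvd hF)
      push_cast [Nat.one_le_iff_ne_zero.2 (Fintype.card_ne_zero (α := F))] at h
      exact h
    have h1' := Int.natCast_dvd_natCast.2 h1
    push_cast at h1'
    refine Int.ModEq.symm (Int.modEq_iff_dvd.2 ?_)
    rw [hT]
    have h3 := dvd_sub h2 (h1'.mul_left (p : ℤ))
    rw [sub_right_comm] at h3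
    convert h3
  have hp3 : 3 ≤ p := by
    have := hp.two_le
    have := H.ne_two
    omega
  rw [hTint, hM]
  have h := int_eq_of_sq_eq hp hp3 hM' hsq H.d_pos hdvd hKle hmod
  rcases h with ⟨h1, h2⟩ | ⟨h1, h2⟩ | ⟨h1, h2⟩
  · left; exact ⟨by rw [h1]; push_cast; rfl, h2⟩
  · right; left; exact ⟨by rw [h1]; push_cast; rfl, h2⟩
  · right; right; exact ⟨by rw [h1]; push_cast; rfl, h2⟩

end IsHermitianCase

end Moments

section Distribution

/-- The possible values of `pairSum`. -/
def typeValue (p m d : ℕ) : Fin 4 → ℂ :=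
  ![-(p : ℂ) ^ m, (p : ℂ) ^ m * (p : ℂ) ^ d, -((p : ℂ) ^ m * ((p : ℂ) ^ d) ^ 2),
    (p : ℂ) ^ m * (p : ℂ) ^ m]

/-- The size of the radical of a form with a given value of `pairSum`. -/
def typeKer (p m d : ℕ) : Fin 4 → ℕ := ![1, (p ^ d) ^ 2, (p ^ d) ^ 4, (p ^ m) ^ 2]

/-- The number of pairs with a given value of `pairSum`. -/
def typeCount (p m k d : ℕ) [Fact p.Prime] (F : Type) [Field F] [Fintype F] [Algebra (ZMod p) F]
    (i : Fin 4) : ℕ :=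
  ((IsHermitianCase.subfieldFinset p m F ×ˢ Finset.univ).filter fun ab =>
    IsHermitianCase.pairSum p m k ab = typeValue p m d i).card

namespace IsHermitianCase

variable {p m n k d : ℕ} [Fact p.Prime] {F : Type} [Field F] [Fintype F] [Algebra (ZMod p) F]

omit [Fact p.Prime] in
lemma norm_typeValue (i : Fin 4) :
    ‖typeValue p m d i‖ = (p : ℝ) ^ (![m, m + d, m + 2 * d, m + m] i) := by
  fin_cases i <;> simp [typeValue, pow_add, pow_mul, mul_comm]

lemma typeValue_ne_zero (i : Fin 4) : typeValue p m d i ≠ 0 := by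
  have hp := (Fact.out : p.Prime)
  rw [← norm_ne_zero_iff, norm_typeValue]
  exact pow_ne_zero _ (Nat.cast_ne_zero.2 hp.ne_zero)

lemma eq_of_norm_typeValue_eq (hd : 0 < d) (hdm : 2 * d < m) {i j : Fin 4}
    (h : ‖typeValue p m d i‖ = ‖typeValue p m d j‖) : i = j := by
  have hp := (Fact.out : p.Prime)
  rw [norm_typeValue, norm_typeValue] at h
  have h' := Nat.pow_right_injective hp.two_le (a₁ := ![m, m + d, m + 2 * d, m + m] i)
    (a₂ := ![m, m + d, m + 2 * d, m + m] j) (by exact_mod_cast h)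
  revert h'
  fin_cases i <;> fin_cases j <;> simp <;> omega

lemma typeKer_pos (i : Fin 4) : 0 < typeKer p m d i := by
  have hp := (Fact.out : p.Prime)
  have h : ∀ j, 0 < p ^ j := fun j => pow_pos hp.pos j
  fin_cases i <;> simp [typeKer, hp.pos]

omit [Fintype F] in
lemma traceForm_zero (x : F) : traceForm p m k 0 0 x = 0 := by
  simp [traceForm]

lemma pairSum_zero (hF : Fintype.card F = p ^ n) : pairSum p m k (0 : F × F) = (p : ℂ) ^ n := by
  simp [pairSum, twistedSum, traceForm_zero, hF]

lemma pairSum_zero_and_card_ker [CharP F p] (h2m : n = 2 * m) (hF : Fintype.card F = p ^ n) :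
    pairSum p m k (0 : F × F) = typeValue p m d 3 ∧
      (Finset.univ.filter fun x : F => phiHom p m n k 0 0 x = 0).card = typeKer p m d 3 := by
  have hp := (Fact.out : p.Prime)
  refine ⟨?_, ?_⟩
  · rw [pairSum_zero hF, h2m]
    simp [typeValue, two_mul, pow_add]
  · have h : ∀ x : F, phiHom p m n k 0 0 x = 0 := by
      intro x
      change phiMap p m n k 0 0 x = 0
      simp [phiMap, zero_pow (pow_ne_zero (n - k) hp.ne_zero)]
    rw [Finset.filter_true_of_mem fun x _ => h x, Finset.card_univ, hF, h2m, mul_comm, pow_mul]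
    rfl

variable (H : IsHermitianCase p m n k d) (hF : Fintype.card F = p ^ n)
include H hF

lemma exists_typeValue [CharP F p] {ab : F × F} (hα : ab.1 ^ p ^ m = ab.1) :
    ∃ i, pairSum p m k ab = typeValue p m d i ∧
      (Finset.univ.filter fun x => phiHom p m n k ab.1 ab.2 x = 0).card = typeKer p m d i := by
  by_cases h0 : ab = 0
  · exact ⟨3, h0 ▸ pairSum_zero_and_card_ker H.n_eq hF⟩
  · rcases H.pairSum_cases hF hα h0 with h | h | h
    · exact ⟨0, h⟩
    · exact ⟨1, h⟩
    · exact ⟨2, h⟩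

lemma card_ker_of_pairSum_eq [CharP F p] (hdm : 2 * d < m) {ab : F × F} (hα : ab.1 ^ p ^ m = ab.1)
    {i : Fin 4} (hi : pairSum p m k ab = typeValue p m d i) :
    (Finset.univ.filter fun x => phiHom p m n k ab.1 ab.2 x = 0).card = typeKer p m d i := by
  obtain ⟨j, hj, hj'⟩ := H.exists_typeValue hF hα
  have hij : i = j := eq_of_norm_typeValue_eq (p := p) H.d_pos hdm (by rw [← hi, hj])
  rwa [hij]

lemma sum_eq_sum_typeCount (hdm : 2 * d < m) (G : F × F → ℂ) (g : Fin 4 → ℂ)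
    (h : ∀ ab : F × F, ab.1 ^ p ^ m = ab.1 → ∀ i, pairSum p m k ab = typeValue p m d i →
      G ab = g i) :
    ∑ ab ∈ subfieldFinset p m F ×ˢ Finset.univ, G ab = ∑ i, (typeCount p m k d F i : ℂ) * g i := by
  have := charP_of_algebra_zmod p F
  have h1 : ∀ ab ∈ subfieldFinset p m F ×ˢ Finset.univ, G ab =
      ∑ i, if pairSum p m k ab = typeValue p m d i then g i else 0 := by
    intro ab hab
    have hα := mem_subfieldFinset.1 (Finset.mem_product.1 hab).1
    obtain ⟨i, hi, -⟩ := H.exists_typeValue hF hα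
    rw [Finset.sum_eq_single i, if_pos hi, h ab hα i hi]
    · intro j _ hji
      refine if_neg fun hj => hji ?_
      exact eq_of_norm_typeValue_eq (p := p) H.d_pos hdm (by rw [← hj, hi])
    · exact fun h => absurd (Finset.mem_univ _) h
  rw [Finset.sum_congr rfl h1, Finset.sum_comm]
  refine Finset.sum_congr rfl fun i _ => ?_
  rw [← Finset.sum_filter, Finset.sum_const, nsmul_eq_mul, typeCount]

lemma typeCount_three [CharP F p] (hdm : 2 * d < m) : typeCount p m k d F 3 = 1 := by
  rw [typeCount, Finset.card_eq_one]
  refine ⟨0, Finset.ext fun ab => ?_⟩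
  have hp := (Fact.out : p.Prime)
  rw [Finset.mem_filter, Finset.mem_product, mem_subfieldFinset, Finset.mem_singleton]
  refine ⟨fun ⟨⟨hα, _⟩, h⟩ => ?_, ?_⟩
  · by_contra h0
    have hne : ∀ i : Fin 4, i ≠ 3 → pairSum p m k ab ≠ typeValue p m d i := by
      intro i hi h'
      exact hi (eq_of_norm_typeValue_eq (p := p) H.d_pos hdm (by rw [← h', h]))
    rcases H.pairSum_cases hF hα h0 with h' | h' | h'
    · exact hne 0 (by decide) h'.1
    · exact hne 1 (by decide) h'.1
    · exact hne 2 (by decide) h'.1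
  · rintro rfl
    exact ⟨⟨by simp [hp.ne_zero], Finset.mem_univ _⟩, (pairSum_zero_and_card_ker H.n_eq hF).1⟩

lemma sum_typeCount (hdm : 2 * d < m) :
    ∑ i, (typeCount p m k d F i : ℂ) = (p : ℂ) ^ m * p ^ n := by
  have h := H.sum_eq_sum_typeCount hF hdm (fun _ => 1) (fun _ => 1) (fun _ _ _ _ => rfl)
  rw [Finset.sum_const, Finset.card_product, H.card_subfieldFinset hF (by omega), Finset.card_univ,
    hF] at h
  simpa using h.symm

lemma sum_typeCount_mul_typeValue (hdm : 2 * d < m) :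
    ∑ i, (typeCount p m k d F i : ℂ) * typeValue p m d i = (p : ℂ) ^ m * p ^ n := by
  rw [← H.sum_pairSum hF (by omega : 0 < m)]
  exact (H.sum_eq_sum_typeCount hF hdm _ _ fun _ _ _ h => h).symm

lemma sum_typeCount_mul_typeValue_sq (hdm : 2 * d < m) :
    ∑ i, (typeCount p m k d F i : ℂ) * typeValue p m d i ^ 2 =
      (p : ℂ) ^ m * p ^ n * (1 + ((p : ℂ) ^ n - 1) * ((p : ℂ) ^ d + 1)) := by
  rw [← H.sum_pairSum_mul_conj hF (by omega : 0 < m)]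
  refine (H.sum_eq_sum_typeCount hF hdm _ _ fun ab _ i h => ?_).symm
  rw [h, sq]
  congr 1
  fin_cases i <;> simp [typeValue]

lemma Scount_eq_sum (v : ℂ) :
    Scount p m n k F v = ∑ ab ∈ subfieldFinset p m F ×ˢ Finset.univ,
      (Finset.univ.filter fun γ =>
        twistedSum (traceHom p F) (traceForm p m k ab.1 ab.2) γ = v).card := by
  rw [Scount, Nat.card_eq_fintype_card, Fintype.card_subtype]
  simp only [Finset.card_filter]
  rw [Fintype.sum_prod_type, Finset.sum_product, subfieldFinset, Finset.sum_filter]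
  refine Finset.sum_congr rfl fun α _ => ?_
  split_ifs with hα
  · rw [Fintype.sum_prod_type]
    simp only [hα, true_and, Ssum_eq_twistedSum H.ne_two H.n_eq hF hα]
  · simp [hα]

lemma exists_twistedSum_eq_mul_pairSum [CharP F p] {α β γ : F} (hα : α ^ p ^ m = α)
    (hγ : twistedSum (traceHom p F) (traceForm p m k α β) γ ≠ 0) :
    ∃ c : ZMod p, twistedSum (traceHom p F) (traceForm p m k α β) γ =
      ZMod.stdAddChar c * pairSum p m k (α, β) := by
  have hf := H.isScalableForm hF hα β
  have hmem : γ ∈ Finset.univ.image (phiHom p m n k α β) := by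
    by_contra h
    exact hγ (hf.twistedSum_eq_zero H.ne_two h)
  obtain ⟨y, -, rfl⟩ := Finset.mem_image.1 hmem
  exact ⟨_, hf.twistedSum_apply y⟩

lemma Scount_mul (hdm : 2 * d < m) (c : ZMod p) (i : Fin 4) :
    (Scount p m n k F (ZMod.stdAddChar c * typeValue p m d i) : ℂ) * (p * typeKer p m d i) =
      typeCount p m k d F i *
        ((p : ℂ) ^ n + typeValue p m d i * (if c = 0 then (p : ℂ) - 1 else -1)) := by
  have := charP_of_algebra_zmod p F
  rw [H.Scount_eq_sum hF, Nat.cast_sum, Finset.sum_mul, H.sum_eq_sum_typeCount hF hdm _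
    (fun j => if j = i then
      (p : ℂ) ^ n + typeValue p m d i * (if c = 0 then (p : ℂ) - 1 else -1) else 0)]
  · simp
  intro ab hα j hj
  have hf := H.isScalableForm hF hα ab.2
  change twistedSum _ _ _ = _ at hj
  have hT : twistedSum (traceHom p F) (traceForm p m k ab.1 ab.2) 0 ≠ 0 :=
    hj ▸ typeValue_ne_zero j
  by_cases hji : j = i
  · rw [if_pos hji]
    subst hji
    have h1 := hf.card_twistedSum_eq_mul H.ne_two c hT
    have h2 := hf.card_fiber_mul (-c)
    rw [H.card_ker_of_pairSum_eq hF hdm hα hj] at h1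
    rw [← h1, hj, hF] at h2
    simp only [neg_eq_zero] at h2
    push_cast at h2
    rw [← h2]
    ring
  · have hempty : (Finset.univ.filter fun γ => twistedSum (traceHom p F)
        (traceForm p m k ab.1 ab.2) γ = ZMod.stdAddChar c * typeValue p m d i) = ∅ := by
      refine Finset.filter_eq_empty_iff.2 fun γ _ hγ => hji ?_
      have hne : twistedSum (traceHom p F) (traceForm p m k ab.1 ab.2) γ ≠ 0 := by
        rw [hγ, ← norm_ne_zero_iff, norm_mul, AddChar.norm_apply, one_mul, norm_ne_zero_iff]
        exact typeValue_ne_zero i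
      obtain ⟨c', hc'⟩ := H.exists_twistedSum_eq_mul_pairSum hF hα hne
      change _ = _ * twistedSum _ _ _ at hc'
      have h := congrArg norm (hc'.symm.trans hγ)
      rw [hj, norm_mul, norm_mul, AddChar.norm_apply, AddChar.norm_apply, one_mul, one_mul] at h
      exact eq_of_norm_typeValue_eq (p := p) H.d_pos hdm h
    rw [hempty, if_neg hji]
    simp

lemma Scount_zero (hdm : 2 * d < m) :
    (Scount p m n k F 0 : ℂ) =
      ∑ i, typeCount p m k d F i * ((p : ℂ) ^ n - (p : ℂ) ^ n / typeKer p m d i) := by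
  have := charP_of_algebra_zmod p F
  rw [H.Scount_eq_sum hF, Nat.cast_sum, H.sum_eq_sum_typeCount hF hdm]
  intro ab hα i hi
  have hf := H.isScalableForm hF hα ab.2
  have hK : (typeKer p m d i : ℂ) ≠ 0 := Nat.cast_ne_zero.2 (typeKer_pos i).ne'
  have h1 := hf.card_twistedSum_eq_zero H.ne_two
  have h2 := IsScalableForm.card_image_mul_card_ker (phiHom p m n k ab.1 ab.2)
  rw [H.card_ker_of_pairSum_eq hF hdm hα hi, hF] at h2
  rw [hF] at h1
  have h1' := congrArg (Nat.cast : ℕ → ℂ) h1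
  have h2' := congrArg (Nat.cast : ℕ → ℂ) h2
  push_cast at h1' h2'
  rw [← h2', mul_div_assoc, div_self hK, mul_one, h2', ← h1']
  ring

end IsHermitianCase

end Distribution

section Solution

/-- The solution of the moment equations for the numbers of pairs of each type. -/
lemma moment_equations_solution {n₀ n₁ n₂ P Q R : ℂ} (hP : P = Q ^ 3 * R) (hQ0 : Q ≠ 0)
    (hP0 : P ≠ 0) (e1 : n₀ + n₁ + n₂ + 1 = P * P ^ 2)
    (e2 : n₀ * -P + n₁ * (P * Q) + n₂ * -(P * Q ^ 2) + P * P = P * P ^ 2)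
    (e3 : n₀ * (-P) ^ 2 + n₁ * (P * Q) ^ 2 + n₂ * (-(P * Q ^ 2)) ^ 2 + (P * P) ^ 2 =
      P * P ^ 2 * (1 + (P ^ 2 - 1) * (Q + 1))) :
    (Q + 1) * (Q ^ 2 - 1) * n₀ = Q ^ 3 * (P - 1) *
      (P ^ 2 - Q ^ 4 * R ^ 2 - Q ^ 3 * R ^ 2 + P - Q ^ 2 * R + 1) ∧
    (Q + 1) ^ 2 * n₁ = (P ^ 2 - 1) * (P * Q + P + Q + Q ^ 2 * R) ∧
    (Q + 1) * (Q ^ 2 - 1) * n₂ = (P ^ 2 - 1) * (Q ^ 2 * R - 1) := by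
  have e2' : -n₀ + n₁ * Q - n₂ * Q ^ 2 + P = P ^ 2 :=
    mul_left_cancel₀ hP0 (by linear_combination e2)
  have e3' : n₀ + n₁ * Q ^ 2 + n₂ * Q ^ 4 + P ^ 2 = P * (1 + (P ^ 2 - 1) * (Q + 1)) :=
    mul_left_cancel₀ (pow_ne_zero 2 hP0) (by linear_combination e3)
  have h2 : Q * ((Q + 1) * (Q ^ 2 - 1) * n₂) = (P ^ 2 - 1) * (P - Q) := by
    linear_combination e3' - e1 - (Q - 1) * (e1 + e2')
  have h1 : Q * ((Q + 1) ^ 2 * n₁) = (P ^ 2 - 1) * (P * Q ^ 2 + P * Q + Q ^ 2 + P) := by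
    linear_combination Q * (Q + 1) * (e1 + e2') + h2
  have h0 : Q * ((Q + 1) * (Q ^ 2 - 1) * n₀) = Q * ((Q + 1) * (Q ^ 2 - 1) * (P ^ 3 - 1)) -
      (P ^ 2 - 1) * (P - Q) - (Q - 1) * ((P ^ 2 - 1) * (P * Q ^ 2 + P * Q + Q ^ 2 + P)) := by
    linear_combination Q * ((Q + 1) * (Q ^ 2 - 1)) * e1 - h2 - (Q - 1) * h1
  subst hP
  refine ⟨mul_left_cancel₀ hQ0 ?_, mul_left_cancel₀ hQ0 ?_, mul_left_cancel₀ hQ0 ?_⟩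
  · linear_combination h0
  · linear_combination h1
  · linear_combination h2

lemma zetaC_pow_eq_stdAddChar (p : ℕ) [Fact p.Prime] (j : ℕ) :
    zetaC p ^ j = ZMod.stdAddChar (j : ZMod p) := by
  have h := ZMod.stdAddChar_coe (N := p) (j : ℤ)
  rw [Int.cast_natCast] at h
  rw [h, zetaC, ← Complex.exp_nat_mul]
  congr 1
  push_cast
  ring

lemma isHermitianCase_of_gcd_eq {p m n k d : ℕ} (hp2 : p ≠ 2) (hm : 0 < m) (hn : n = 2 * m)
    (hk : k ≤ n - 1) (hkm : k ≠ m) (hd : d = Nat.gcd m k)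
    (hd' : Nat.gcd (m + k) (2 * k) = 2 * d) : IsHermitianCase p m n k d ∧ 3 * d ≤ m := by
  have hd0 : 0 < d := hd ▸ Nat.gcd_pos_of_pos_left _ hm
  obtain ⟨M, K, hco, hM, hK⟩ := Nat.exists_coprime m k
  rw [← hd, mul_comm] at hM hK
  have hg : Nat.gcd (M + K) (2 * K) = 2 := by
    refine Nat.eq_of_mul_eq_mul_left hd0 ?_
    rw [← Nat.gcd_mul_left, mul_add, mul_left_comm, ← hM, ← hK, hd', mul_comm]
  have heven : 2 ∣ M + K := hg ▸ Nat.gcd_dvd_left _ _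
  have hnot : ¬ (2 ∣ M ∧ 2 ∣ K) := fun h => by
    have := Nat.dvd_gcd h.1 h.2
    rw [hco] at this
    omega
  have hMo : Odd M := by rw [Nat.odd_iff]; omega
  have hKo : Odd K := by rw [Nat.odd_iff]; omega
  have hsym : Nat.gcd (m + k) n = Nat.gcd (m + k) (2 * k) := by
    rw [hn]
    refine Nat.dvd_antisymm (Nat.dvd_gcd (Nat.gcd_dvd_left _ _) ?_)
      (Nat.dvd_gcd (Nat.gcd_dvd_left _ _) ?_)
    · refine (Nat.dvd_add_right (Nat.gcd_dvd_right (m + k) (2 * m))).1 ?_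
      rw [← mul_add]
      exact (Nat.gcd_dvd_left _ _).mul_left 2
    · refine (Nat.dvd_add_left (Nat.gcd_dvd_right (m + k) (2 * k))).1 ?_
      rw [← mul_add]
      exact (Nat.gcd_dvd_left _ _).mul_left 2
  refine ⟨⟨hp2, hd0, hn, by omega, ⟨M, hM, hMo⟩, ⟨K, hK, hKo⟩, hsym.trans hd', ?_⟩, ?_⟩
  · rw [hn, Nat.gcd_mul_left, Nat.gcd_comm, hd]
  · obtain ⟨a, ha⟩ := hMo
    obtain ⟨b, hb⟩ := hKo
    rcases Nat.eq_zero_or_pos a with h0 | h0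
    · exfalso
      have hmd : m = d := by rw [hM, ha, h0]; ring
      rcases Nat.eq_zero_or_pos b with h1 | h1
      · exact hkm (by rw [hK, hb, h1, hmd]; ring)
      · have : d * 3 ≤ d * K := Nat.mul_le_mul_left d (by omega)
        omega
    · have : d * 3 ≤ d * M := Nat.mul_le_mul_left d (by omega)
      omega

namespace IsHermitianCase

variable {p m n k d r : ℕ} [Fact p.Prime] {F : Type} [Field F] [Fintype F] [Algebra (ZMod p) F]
variable (H : IsHermitianCase p m n k d) (hF : Fintype.card F = p ^ n) (hr : m = 3 * d + r)
include H hF hr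

lemma typeCount_eq : let P := (p : ℂ) ^ m; let Q := (p : ℂ) ^ d; let R := (p : ℂ) ^ r
    (Q + 1) * (Q ^ 2 - 1) * typeCount p m k d F 0 = Q ^ 3 * (P - 1) *
      (P ^ 2 - Q ^ 4 * R ^ 2 - Q ^ 3 * R ^ 2 + P - Q ^ 2 * R + 1) ∧
    (Q + 1) ^ 2 * typeCount p m k d F 1 = (P ^ 2 - 1) * (P * Q + P + Q + Q ^ 2 * R) ∧
    (Q + 1) * (Q ^ 2 - 1) * typeCount p m k d F 2 = (P ^ 2 - 1) * (Q ^ 2 * R - 1) := by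
  intro P Q R
  have := charP_of_algebra_zmod p F
  have hp := (Fact.out : p.Prime)
  have hp0 : (p : ℂ) ≠ 0 := Nat.cast_ne_zero.2 hp.ne_zero
  have hd := H.d_pos
  have hdm : 2 * d < m := by omega
  have hPn : (p : ℂ) ^ n = P ^ 2 := by rw [H.n_eq, mul_comm, pow_mul]
  have e1 := H.sum_typeCount hF hdm
  have e2 := H.sum_typeCount_mul_typeValue hF hdm
  have e3 := H.sum_typeCount_mul_typeValue_sq hF hdm
  rw [Fin.sum_univ_four, H.typeCount_three hF hdm, hPn, Nat.cast_one] at e1 e2 e3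
  rw [one_mul] at e2 e3
  have h7 : (p : ℂ) ^ m = ((p : ℂ) ^ d) ^ 3 * (p : ℂ) ^ r := by
    rw [← pow_mul, ← pow_add]; congr 1; omega
  exact moment_equations_solution h7 (pow_ne_zero _ hp0) (pow_ne_zero _ hp0) e1 e2 e3

lemma Scount_typeValue_zero_eq (c : ZMod p) : let δ : ℂ := if c = 0 then (p : ℂ) - 1 else -1
    ((p : ℂ) ^ d + 1) * ((p : ℂ) ^ (2 * d) - 1) *
        Scount p m n k F (ZMod.stdAddChar c * -(p : ℂ) ^ m) =
      (p : ℂ) ^ (m + 3 * d - 1) * ((p : ℂ) ^ m - 1) * ((p : ℂ) ^ m - δ) *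
        ((p : ℂ) ^ n - (p : ℂ) ^ (n - 2 * d) - (p : ℂ) ^ (n - 3 * d) + (p : ℂ) ^ m -
          (p : ℂ) ^ (m - d) + 1) := by
  intro δ
  have hp0 : (p : ℂ) ≠ 0 := Nat.cast_ne_zero.2 (Fact.out : p.Prime).ne_zero
  have hd := H.d_pos
  have hn := H.n_eq
  have hS := H.Scount_mul hF (by omega : 2 * d < m) c 0
  change (Scount p m n k F (ZMod.stdAddChar c * -(p : ℂ) ^ m) : ℂ) * (p * (1 : ℕ)) =
    typeCount p m k d F 0 * ((p : ℂ) ^ n + -(p : ℂ) ^ m * δ) at hS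
  have hN := (H.typeCount_eq hF hr).1
  have h1 : (p : ℂ) * (p : ℂ) ^ (m + 3 * d - 1) = (p : ℂ) ^ m * ((p : ℂ) ^ d) ^ 3 := by
    rw [← pow_succ', ← pow_mul, ← pow_add]; congr 1; omega
  have h2 : (p : ℂ) ^ n = ((p : ℂ) ^ m) ^ 2 := by rw [← pow_mul]; congr 1; omega
  have h3 : (p : ℂ) ^ (n - 2 * d) = ((p : ℂ) ^ d) ^ 4 * ((p : ℂ) ^ r) ^ 2 := by
    rw [← pow_mul, ← pow_mul, ← pow_add]; congr 1; omega
  have h4 : (p : ℂ) ^ (n - 3 * d) = ((p : ℂ) ^ d) ^ 3 * ((p : ℂ) ^ r) ^ 2 := by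
    rw [← pow_mul, ← pow_mul, ← pow_add]; congr 1; omega
  have h5 : (p : ℂ) ^ (m - d) = ((p : ℂ) ^ d) ^ 2 * (p : ℂ) ^ r := by
    rw [← pow_mul, ← pow_add]; congr 1; omega
  have h6 : (p : ℂ) ^ (2 * d) = ((p : ℂ) ^ d) ^ 2 := by rw [← pow_mul, mul_comm]
  rw [h2, Nat.cast_one] at hS
  rw [h2, h3, h4, h5, h6]
  generalize (p : ℂ) ^ d = Q, (p : ℂ) ^ m = P, (p : ℂ) ^ r = R at *
  refine mul_left_cancel₀ hp0 ?_
  linear_combination (Q + 1) * (Q ^ 2 - 1) * hS + (P ^ 2 - P * δ) * hN - (P - 1) * (P - δ) *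
    (P ^ 2 - Q ^ 4 * R ^ 2 - Q ^ 3 * R ^ 2 + P - Q ^ 2 * R + 1) * h1

lemma Scount_typeValue_one_eq (c : ZMod p) : let δ : ℂ := if c = 0 then (p : ℂ) - 1 else -1
    ((p : ℂ) ^ d + 1) ^ 2 * Scount p m n k F (ZMod.stdAddChar c * (p : ℂ) ^ (m + d)) =
      (p : ℂ) ^ (m - 1) * ((p : ℂ) ^ n - 1) * ((p : ℂ) ^ (m - d) + δ) *
        ((p : ℂ) ^ m + (p : ℂ) ^ (m - d) + (p : ℂ) ^ (m - 2 * d) + 1) := by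
  intro δ
  have hp0 : (p : ℂ) ≠ 0 := Nat.cast_ne_zero.2 (Fact.out : p.Prime).ne_zero
  have hd := H.d_pos
  have hn := H.n_eq
  have hS := H.Scount_mul hF (by omega : 2 * d < m) c 1
  change (Scount p m n k F (ZMod.stdAddChar c * ((p : ℂ) ^ m * (p : ℂ) ^ d)) : ℂ) *
      (p * ((p ^ d) ^ 2 : ℕ)) =
    typeCount p m k d F 1 * ((p : ℂ) ^ n + ((p : ℂ) ^ m * (p : ℂ) ^ d) * δ) at hS
  have hN := (H.typeCount_eq hF hr).2.1
  have hQ0 : (p : ℂ) ^ d ≠ 0 := pow_ne_zero _ hp0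
  have h1 : (p : ℂ) * (p : ℂ) ^ (m - 1) = (p : ℂ) ^ m := by
    rw [← pow_succ']; congr 1; omega
  have h2 : (p : ℂ) ^ n = ((p : ℂ) ^ m) ^ 2 := by rw [← pow_mul]; congr 1; omega
  have h3 : (p : ℂ) ^ (m - 2 * d) = (p : ℂ) ^ d * (p : ℂ) ^ r := by
    rw [← pow_add]; congr 1; omega
  have h5 : (p : ℂ) ^ (m - d) = ((p : ℂ) ^ d) ^ 2 * (p : ℂ) ^ r := by
    rw [← pow_mul, ← pow_add]; congr 1; omega
  have h7 : (p : ℂ) ^ m = ((p : ℂ) ^ d) ^ 3 * (p : ℂ) ^ r := by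
    rw [← pow_mul, ← pow_add]; congr 1; omega
  push_cast at hS
  rw [h2, ← pow_add] at hS
  rw [h2, h3, h5]
  rw [pow_add] at hS ⊢
  generalize (Scount p m n k F _ : ℂ) = S at *
  generalize (p : ℂ) ^ d = Q, (p : ℂ) ^ m = P, (p : ℂ) ^ r = R at *
  refine mul_left_cancel₀ (mul_ne_zero hp0 (pow_ne_zero 2 hQ0)) ?_
  subst h7
  linear_combination (Q + 1) ^ 2 * hS + ((Q ^ 3 * R) ^ 2 + Q ^ 3 * R * Q * δ) * hN - Q ^ 2 *
    ((Q ^ 3 * R) ^ 2 - 1) * (Q ^ 2 * R + δ) * (Q ^ 3 * R + Q ^ 2 * R + Q * R + 1) * h1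

lemma Scount_typeValue_two_eq (c : ZMod p) : let δ : ℂ := if c = 0 then (p : ℂ) - 1 else -1
    ((p : ℂ) ^ d + 1) * ((p : ℂ) ^ (2 * d) - 1) *
        Scount p m n k F (ZMod.stdAddChar c * -(p : ℂ) ^ (m + 2 * d)) =
      (p : ℂ) ^ (m - 2 * d - 1) * ((p : ℂ) ^ (m - d) - 1) * ((p : ℂ) ^ (m - 2 * d) - δ) *
        ((p : ℂ) ^ n - 1) := by
  intro δ
  have hp0 : (p : ℂ) ≠ 0 := Nat.cast_ne_zero.2 (Fact.out : p.Prime).ne_zero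
  have hd := H.d_pos
  have hn := H.n_eq
  have hS := H.Scount_mul hF (by omega : 2 * d < m) c 2
  change (Scount p m n k F (ZMod.stdAddChar c * -((p : ℂ) ^ m * ((p : ℂ) ^ d) ^ 2)) : ℂ) *
      (p * ((p ^ d) ^ 4 : ℕ)) =
    typeCount p m k d F 2 * ((p : ℂ) ^ n + -((p : ℂ) ^ m * ((p : ℂ) ^ d) ^ 2) * δ) at hS
  have hN := (H.typeCount_eq hF hr).2.2
  have hQ0 : (p : ℂ) ^ d ≠ 0 := pow_ne_zero _ hp0
  have h1 : (p : ℂ) * (p : ℂ) ^ (m - 2 * d - 1) = (p : ℂ) ^ d * (p : ℂ) ^ r := by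
    rw [← pow_succ', ← pow_add]; congr 1; omega
  have h2 : (p : ℂ) ^ n = ((p : ℂ) ^ m) ^ 2 := by rw [← pow_mul]; congr 1; omega
  have h3 : (p : ℂ) ^ (m - 2 * d) = (p : ℂ) ^ d * (p : ℂ) ^ r := by
    rw [← pow_add]; congr 1; omega
  have h5 : (p : ℂ) ^ (m - d) = ((p : ℂ) ^ d) ^ 2 * (p : ℂ) ^ r := by
    rw [← pow_mul, ← pow_add]; congr 1; omega
  have h6 : (p : ℂ) ^ (2 * d) = ((p : ℂ) ^ d) ^ 2 := by rw [← pow_mul, mul_comm]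
  have h7 : (p : ℂ) ^ m = ((p : ℂ) ^ d) ^ 3 * (p : ℂ) ^ r := by
    rw [← pow_mul, ← pow_add]; congr 1; omega
  push_cast at hS
  rw [h2] at hS
  rw [pow_add, h2, h3, h5, h6]
  generalize (Scount p m n k F _ : ℂ) = S at *
  generalize (p : ℂ) ^ d = Q, (p : ℂ) ^ m = P, (p : ℂ) ^ r = R at *
  refine mul_left_cancel₀ (mul_ne_zero hp0 (pow_ne_zero 4 hQ0)) ?_
  subst h7
  linear_combination (Q + 1) * (Q ^ 2 - 1) * hS +
    ((Q ^ 3 * R) ^ 2 - Q ^ 3 * R * Q ^ 2 * δ) * hN -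
    Q ^ 4 * ((Q ^ 3 * R) ^ 2 - 1) * (Q ^ 2 * R - 1) * (Q * R - δ) * h1

lemma Scount_zero_eq :
    (Scount p m n k F 0 : ℂ) = ((p : ℂ) ^ n - 1) * ((p : ℂ) ^ (3 * m - d) -
      (p : ℂ) ^ (3 * m - 2 * d) + (p : ℂ) ^ (3 * m - 3 * d) - (p : ℂ) ^ (3 * m - 4 * d) +
      (p : ℂ) ^ (3 * m - 5 * d) + (p : ℂ) ^ (n - d) - 2 * (p : ℂ) ^ (n - 2 * d) +
      (p : ℂ) ^ (n - 3 * d) - (p : ℂ) ^ (n - 4 * d) + 1) := by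
  have := charP_of_algebra_zmod p F
  have hp := (Fact.out : p.Prime)
  have hp0 : (p : ℂ) ≠ 0 := Nat.cast_ne_zero.2 hp.ne_zero
  have hd := H.d_pos
  have hn := H.n_eq
  have hS := H.Scount_zero hF (by omega : 2 * d < m)
  rw [Fin.sum_univ_four, H.typeCount_three hF (by omega)] at hS
  simp only [typeKer, Matrix.cons_val] at hS
  push_cast at hS
  obtain ⟨-, hN1, hN2⟩ := H.typeCount_eq hF hr
  have hQ0 : (p : ℂ) ^ d ≠ 0 := pow_ne_zero _ hp0
  have hR0 : (p : ℂ) ^ r ≠ 0 := pow_ne_zero _ hp0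
  have hQ1 : (p : ℂ) ^ d + 1 ≠ 0 := by exact_mod_cast Nat.succ_ne_zero (p ^ d)
  have hQ2 : ((p : ℂ) ^ d) ^ 2 - 1 ≠ 0 := by
    rw [sub_ne_zero, ← pow_mul]
    exact_mod_cast (Nat.one_lt_pow (by omega) hp.one_lt).ne'
  have h2 : (p : ℂ) ^ n = ((p : ℂ) ^ m) ^ 2 := by rw [← pow_mul]; congr 1; omega
  have h7 : (p : ℂ) ^ m = ((p : ℂ) ^ d) ^ 3 * (p : ℂ) ^ r := by
    rw [← pow_mul, ← pow_add]; congr 1; omega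
  have h : ∀ e i j : ℕ, e = d * i + r * j → (p : ℂ) ^ e = ((p : ℂ) ^ d) ^ i * ((p : ℂ) ^ r) ^ j := by
    rintro e i j rfl
    rw [← pow_mul, ← pow_mul, ← pow_add]
  rw [h (3 * m - d) 8 3 (by omega), h (3 * m - 2 * d) 7 3 (by omega),
    h (3 * m - 3 * d) 6 3 (by omega), h (3 * m - 4 * d) 5 3 (by omega),
    h (3 * m - 5 * d) 4 3 (by omega), h (n - d) 5 2 (by omega), h (n - 2 * d) 4 2 (by omega),
    h (n - 3 * d) 3 2 (by omega), h (n - 4 * d) 2 2 (by omega), h2]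
  rw [h2] at hS
  rw [hS]
  clear h hS h2
  generalize (p : ℂ) ^ d = Q, (p : ℂ) ^ m = P, (p : ℂ) ^ r = R at *
  subst h7
  refine mul_left_cancel₀ (mul_ne_zero hQ1 (mul_ne_zero hQ1 hQ2)) ?_
  have d1 : (Q ^ 3 * R) ^ 2 / Q ^ 2 = Q ^ 4 * R ^ 2 := by field_simp
  have d2 : (Q ^ 3 * R) ^ 2 / Q ^ 4 = Q ^ 2 * R ^ 2 := by field_simp
  have d3 : (Q ^ 3 * R) ^ 2 / (Q ^ 3 * R) ^ 2 = 1 := by field_simp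
  rw [d1, d2, d3]
  linear_combination (Q ^ 2 - 1) * (Q ^ 6 * R ^ 2 - Q ^ 4 * R ^ 2) * hN1 +
    (Q + 1) * (Q ^ 6 * R ^ 2 - Q ^ 2 * R ^ 2) * hN2

lemma Scount_pow_eq_one : Scount p m n k F ((p : ℂ) ^ n) = 1 := by
  have := charP_of_algebra_zmod p F
  have hp0 : (p : ℂ) ≠ 0 := Nat.cast_ne_zero.2 (Fact.out : p.Prime).ne_zero
  have hd := H.d_pos
  have hS := H.Scount_mul hF (by omega : 2 * d < m) 0 3
  rw [H.typeCount_three hF (by omega), if_pos rfl] at hS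
  change (Scount p m n k F (ZMod.stdAddChar (0 : ZMod p) * ((p : ℂ) ^ m * (p : ℂ) ^ m)) : ℂ) *
      (p * ((p ^ m) ^ 2 : ℕ)) =
    (1 : ℕ) * ((p : ℂ) ^ n + ((p : ℂ) ^ m * (p : ℂ) ^ m) * (p - 1)) at hS
  rw [AddChar.map_zero_eq_one, one_mul, ← pow_add, ← two_mul, ← H.n_eq] at hS
  have h : (p : ℂ) ^ n = ((p : ℂ) ^ m) ^ 2 := by rw [H.n_eq, mul_comm, pow_mul]
  push_cast at hS
  rw [← h] at hS
  have h1 : (Scount p m n k F ((p : ℂ) ^ n) : ℂ) = 1 :=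
    mul_right_cancel₀ (mul_ne_zero hp0 (pow_ne_zero n hp0)) (by linear_combination hS)
  exact_mod_cast h1

omit hr in
lemma Ssum_cases {α : F} (hα : α ^ p ^ m = α) (β γ : F) :
    (∃ c : ZMod p, Ssum p m n k F α β γ = ZMod.stdAddChar c * -(p : ℂ) ^ m ∨
      Ssum p m n k F α β γ = ZMod.stdAddChar c * (p : ℂ) ^ (m + d) ∨
      Ssum p m n k F α β γ = ZMod.stdAddChar c * -(p : ℂ) ^ (m + 2 * d)) ∨
    Ssum p m n k F α β γ = 0 ∨ Ssum p m n k F α β γ = (p : ℂ) ^ n := by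
  have := charP_of_algebra_zmod p F
  rw [Ssum_eq_twistedSum H.ne_two H.n_eq hF hα]
  by_cases h0 : (α, β) = (0 : F × F)
  · obtain ⟨rfl, rfl⟩ := Prod.ext_iff.1 h0
    right
    simp only [Prod.fst_zero, Prod.snd_zero, twistedSum, traceForm_zero, zero_add, mul_comm γ]
    rw [sum_stdAddChar_mul traceHom_nondeg, hF]
    split_ifs <;> simp
  by_cases hγ : twistedSum (traceHom p F) (traceForm p m k α β) γ = 0
  · exact Or.inr (Or.inl hγ)
  obtain ⟨c, hc⟩ := H.exists_twistedSum_eq_mul_pairSum hF hα hγ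
  refine Or.inl ⟨c, ?_⟩
  rw [hc, pow_add _ m d, pow_add _ m (2 * d), mul_comm 2 d, pow_mul]
  rcases H.pairSum_cases hF hα h0 with h | h | h
  · exact Or.inl (by rw [h.1])
  · exact Or.inr (Or.inl (by rw [h.1]))
  · exact Or.inr (Or.inr (by rw [h.1]))

end IsHermitianCase

end Solution

theorem stmt16 (p m k n d d' : ℕ) (hp : Nat.Prime p) (hodd : p % 2 = 1)
    (hm : 0 < m) (hn : n = 2 * m) (hk : k ≤ n - 1) (hkm : k ≠ m)
    (hd : d = Nat.gcd m k) (hd' : d' = Nat.gcd (m + k) (2 * k))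
    (F : Type) [Field F] [Fintype F] [Algebra (ZMod p) F] (hF : Fintype.card F = p ^ n) (hcase : d' = 2 * d) :
    (((p : ℤ) ^ d + 1) * ((p : ℤ) ^ (2 * d) - 1) * (Scount p m n k F (-(p : ℂ) ^ m) : ℤ)
        = (p : ℤ) ^ (m + 3 * d - 1) * ((p : ℤ) ^ m - 1) * ((p : ℤ) ^ m - (p : ℤ) + 1)
          * ((p : ℤ) ^ n - (p : ℤ) ^ (n - 2 * d) - (p : ℤ) ^ (n - 3 * d)
              + (p : ℤ) ^ m - (p : ℤ) ^ (m - d) + 1)) ∧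
    (∀ j : ℕ, 1 ≤ j → j ≤ p - 1 →
      ((p : ℤ) ^ d + 1) * ((p : ℤ) ^ (2 * d) - 1)
          * (Scount p m n k F (-(zetaC p ^ j * (p : ℂ) ^ m)) : ℤ)
        = (p : ℤ) ^ (m + 3 * d - 1) * ((p : ℤ) ^ n - 1)
          * ((p : ℤ) ^ n - (p : ℤ) ^ (n - 2 * d) - (p : ℤ) ^ (n - 3 * d)
              + (p : ℤ) ^ m - (p : ℤ) ^ (m - d) + 1)) ∧
    (((p : ℤ) ^ d + 1) ^ 2 * (Scount p m n k F ((p : ℂ) ^ (m + d)) : ℤ)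
        = (p : ℤ) ^ (m - 1) * ((p : ℤ) ^ n - 1) * ((p : ℤ) ^ (m - d) + (p : ℤ) - 1)
          * ((p : ℤ) ^ m + (p : ℤ) ^ (m - d) + (p : ℤ) ^ (m - 2 * d) + 1)) ∧
    (∀ j : ℕ, 1 ≤ j → j ≤ p - 1 →
      ((p : ℤ) ^ d + 1) ^ 2 * (Scount p m n k F (zetaC p ^ j * (p : ℂ) ^ (m + d)) : ℤ)
        = (p : ℤ) ^ (m - 1) * ((p : ℤ) ^ n - 1) * ((p : ℤ) ^ (m - d) - 1)
          * ((p : ℤ) ^ m + (p : ℤ) ^ (m - d) + (p : ℤ) ^ (m - 2 * d) + 1)) ∧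
    (((p : ℤ) ^ d + 1) * ((p : ℤ) ^ (2 * d) - 1)
        * (Scount p m n k F (-(p : ℂ) ^ (m + 2 * d)) : ℤ)
        = (p : ℤ) ^ (m - 2 * d - 1) * ((p : ℤ) ^ (m - d) - 1)
          * ((p : ℤ) ^ (m - 2 * d) - (p : ℤ) + 1) * ((p : ℤ) ^ n - 1)) ∧
    (∀ j : ℕ, 1 ≤ j → j ≤ p - 1 →
      ((p : ℤ) ^ d + 1) * ((p : ℤ) ^ (2 * d) - 1)
          * (Scount p m n k F (-(zetaC p ^ j * (p : ℂ) ^ (m + 2 * d))) : ℤ)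
        = (p : ℤ) ^ (m - 2 * d - 1) * ((p : ℤ) ^ (m - d) - 1)
          * ((p : ℤ) ^ (m - 2 * d) + 1) * ((p : ℤ) ^ n - 1)) ∧
    ((Scount p m n k F 0 : ℤ)
        = ((p : ℤ) ^ n - 1) * ((p : ℤ) ^ (3 * m - d) - (p : ℤ) ^ (3 * m - 2 * d)
            + (p : ℤ) ^ (3 * m - 3 * d) - (p : ℤ) ^ (3 * m - 4 * d)
            + (p : ℤ) ^ (3 * m - 5 * d) + (p : ℤ) ^ (n - d) - 2 * (p : ℤ) ^ (n - 2 * d)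
            + (p : ℤ) ^ (n - 3 * d) - (p : ℤ) ^ (n - 4 * d) + 1)) ∧
    (Scount p m n k F ((p : ℂ) ^ n) = 1) ∧
    (∀ α β γ : F, α ^ p ^ m = α →
      Ssum p m n k F α β γ = -(p : ℂ) ^ m ∨
      (∃ j : ℕ, 1 ≤ j ∧ j ≤ p - 1 ∧ Ssum p m n k F α β γ = -(zetaC p ^ j * (p : ℂ) ^ m)) ∨
      Ssum p m n k F α β γ = (p : ℂ) ^ (m + d) ∨
      (∃ j : ℕ, 1 ≤ j ∧ j ≤ p - 1 ∧ Ssum p m n k F α β γ = zetaC p ^ j * (p : ℂ) ^ (m + d)) ∨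
      Ssum p m n k F α β γ = -(p : ℂ) ^ (m + 2 * d) ∨
      (∃ j : ℕ, 1 ≤ j ∧ j ≤ p - 1 ∧
        Ssum p m n k F α β γ = -(zetaC p ^ j * (p : ℂ) ^ (m + 2 * d))) ∨
      Ssum p m n k F α β γ = 0 ∨
      Ssum p m n k F α β γ = (p : ℂ) ^ n) := by
  have : Fact p.Prime := ⟨hp⟩
  obtain ⟨H, h3⟩ := isHermitianCase_of_gcd_eq (p := p) (by omega) hm hn hk hkm hd (hd' ▸ hcase)
  obtain ⟨r, hr⟩ := Nat.exists_eq_add_of_le h3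
  have hone : ∀ v : ℂ, v = ZMod.stdAddChar (0 : ZMod p) * v := fun v => by
    rw [AddChar.map_zero_eq_one, one_mul]
  have hj0 : ∀ j : ℕ, 1 ≤ j → j ≤ p - 1 → (j : ZMod p) ≠ 0 := by
    intro j h1 h2 h
    have := Nat.le_of_dvd h1 ((ZMod.natCast_eq_zero_iff j p).1 h)
    have := hp.pos
    omega
  have h0 := H.Scount_typeValue_zero_eq hF hr
  have h1 := H.Scount_typeValue_one_eq hF hr
  have h2 := H.Scount_typeValue_two_eq hF hr
  have cases_char : ∀ c : ZMod p, c = 0 ∨ ∃ j : ℕ, 1 ≤ j ∧ j ≤ p - 1 ∧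
      ZMod.stdAddChar c = zetaC p ^ j := by
    intro c
    refine or_iff_not_imp_left.2 fun hc => ⟨c.val, ?_, Nat.le_sub_one_of_lt c.val_lt, ?_⟩
    · exact Nat.one_le_iff_ne_zero.2 fun h => hc ((ZMod.val_eq_zero c).1 h)
    · rw [zetaC_pow_eq_stdAddChar, ZMod.natCast_zmod_val]
  refine ⟨?_, ?_, ?_, ?_, ?_, ?_, ?_, H.Scount_pow_eq_one hF hr, ?_⟩
  · have h := h0 0
    rw [← hone, if_pos rfl] at h
    rw [← Int.cast_inj (α := ℂ)]
    push_cast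
    linear_combination h
  · intro j hj hj'
    have h := h0 j
    rw [if_neg (hj0 j hj hj'), ← zetaC_pow_eq_stdAddChar, mul_neg] at h
    rw [← Int.cast_inj (α := ℂ)]
    push_cast
    have hP : (p : ℂ) ^ n = ((p : ℂ) ^ m) ^ 2 := by rw [hn, mul_comm, pow_mul]
    rw [hP] at h ⊢
    linear_combination h
  · have h := h1 0
    rw [← hone, if_pos rfl] at h
    rw [← Int.cast_inj (α := ℂ)]
    push_cast
    linear_combination h
  · intro j hj hj'
    have h := h1 j
    rw [if_neg (hj0 j hj hj'), ← zetaC_pow_eq_stdAddChar] at h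
    rw [← Int.cast_inj (α := ℂ)]
    push_cast
    linear_combination h
  · have h := h2 0
    rw [← hone, if_pos rfl] at h
    rw [← Int.cast_inj (α := ℂ)]
    push_cast
    linear_combination h
  · intro j hj hj'
    have h := h2 j
    rw [if_neg (hj0 j hj hj'), ← zetaC_pow_eq_stdAddChar, mul_neg] at h
    rw [← Int.cast_inj (α := ℂ)]
    push_cast
    linear_combination h
  · rw [← Int.cast_inj (α := ℂ)]
    push_cast
    exact H.Scount_zero_eq hF hr
  · intro α β γ hα
    rcases H.Ssum_cases hF hα β γ with ⟨c, hc⟩ | h | h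
    · rcases cases_char c with rfl | ⟨j, hj, hj', hcj⟩
      · rw [← hone, ← hone, ← hone] at hc
        tauto
      · rw [hcj, mul_neg, mul_neg] at hc
        rcases hc with hc | hc | hc
        · exact Or.inr (Or.inl ⟨j, hj, hj', hc⟩)
        · exact Or.inr (Or.inr (Or.inr (Or.inl ⟨j, hj, hj', hc⟩)))
        · exact Or.inr (Or.inr (Or.inr (Or.inr (Or.inr (Or.inl ⟨j, hj, hj', hc⟩)))))
    · tauto
    · tauto
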